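/- arXiv:2410.19242 — 8 statements merged into one kernel-verified Lean document; each statement's English description precedes it below -/
import Mathlib

section
/- Let f = x_1^{a_1}⋯x_m^{a_m} and g = x_1^{b_1}⋯x_m^{b_m} be monomials in x_1,…,x_m over 𝔽₂. Suppose that either (I) g is a factor of f, i.e. b_i = 1 implies a_i = 1 for every 1 ≤ i ≤ m, or (II) f and g have the same degree and f ≼ g. Then D(a_m,…,a_1) ≤ D(b_m,…,b_1), i.e. Σ_{i=1}^m 2^{m−i}(1 − a_i) ≤ Σ_{i=1}^m 2^{m−i}(1 − b_i) (entries regarded as integers 0 or 1); consequently g precedes f in the bit-reversal shortening order. -/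
open Finset

/-- Points of 𝔽₂^m (exponent/evaluation index vectors), 0-based coordinates:
coordinate `i : Fin m` corresponds to the paper's variable `x_{i+1}`. -/
abbrev Pt (m : ℕ) := Fin m → ZMod 2

/-- Multilinear polynomials over 𝔽₂ in x_1,…,x_m, represented (bijectively) by
their evaluation functions 𝔽₂^m → 𝔽₂. -/
abbrev BPoly (m : ℕ) := Pt m → ZMod 2

/-- D(a) = Σ_{i=1}^m 2^{i-1}(a_i ⊕ 1) + 1. -/
def Dnat {m : ℕ} (a : Pt m) : ℕ := (∑ i : Fin m, 2 ^ (i : ℕ) * (1 - (a i).val)) + 1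

/-- D(a_m,…,a_1) = Σ_{i=1}^m 2^{m-i}(a_i ⊕ 1) + 1 (the bit-reversed index). -/
def Drev {m : ℕ} (a : Pt m) : ℕ := (∑ i : Fin m, 2 ^ (m - 1 - (i : ℕ)) * (1 - (a i).val)) + 1

/-- Hamming weight of the window ev(p)_{[s,t]} (positions s..t, 1-based). -/
def wtIn {m : ℕ} (p : BPoly m) (s t : ℕ) : ℕ :=
  (Finset.univ.filter (fun a : Pt m => s ≤ Dnat a ∧ Dnat a ≤ t ∧ p a = 1)).card

/-- Hamming weight of ev(p). -/
def wt {m : ℕ} (p : BPoly m) : ℕ :=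
  (Finset.univ.filter (fun a : Pt m => p a = 1)).card

/-- T(f) for the monomial f with (0-based) index set S:
all products ∏_{j∈S} (x_j + Σ_{k∈B(f,j)} a_{j,k} x_k + a_{j,0}),
where B(f,j) = {k < j : k ∉ S}. -/
def Tset {m : ℕ} (S : Finset (Fin m)) : Set (BPoly m) :=
  {p | ∃ (c : Fin m → Fin m → ZMod 2) (c0 : Fin m → ZMod 2),
    p = fun x => ∏ j ∈ S,
      (x j + (∑ k ∈ Finset.univ.filter (fun k => k < j ∧ k ∉ S), c j k * x k) + c0 j)}

/-- λ_f = 2^{Σ_{t=1}^r (i_t - t + 1)} (here with 0-based sorted indices: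
the t-th smallest element e_t of S contributes e_t - t + 1, t = 0,…,r-1). -/
def lam {m : ℕ} (S : Finset (Fin m)) : ℕ :=
  2 ^ ∑ t : Fin S.card, (((S.orderIsoOfFin rfl t : Fin m) : ℕ) - (t : ℕ) + 1)

/-- Support of an exponent vector, i.e. the index set of the monomial it encodes. -/
def suppOf {m : ℕ} (b : Pt m) : Finset (Fin m) :=
  Finset.univ.filter (fun k => b k = 1)

/-- Coefficient of the monomial with index set S in the multilinear expansion of p
(Möbius inversion over 𝔽₂: c_S = Σ_{a with supp a ⊆ S} p(a)). -/
def coeff {m : ℕ} (S : Finset (Fin m)) (p : BPoly m) : ZMod 2 :=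
  ∑ a ∈ Finset.univ.filter (fun a : Pt m => ∀ i, a i = 1 → i ∈ S), p a

/-- T_S^c(f,i): members of T(f) whose coefficients vanish on each of the first i
monomials in the bit-reversal shortening order (g is among the first i shortened
monomials iff Drev g ≥ 2^m - i + 1). -/
def TSc {m : ℕ} (S : Finset (Fin m)) (i : ℕ) : Set (BPoly m) :=
  {p | p ∈ Tset S ∧ ∀ b : Pt m, 2 ^ m - i + 1 ≤ Drev b → coeff (suppOf b) p = 0}

/-- Exponent vector of the monomial with index set S. -/
def indOf {m : ℕ} (S : Finset (Fin m)) : Pt m := fun k => if k ∈ S then 1 else 0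

/-- β_f(i): number of monomials among the first i shortened (bit-reversal order)
that are factors of the monomial with index set S. -/
noncomputable def betaf {m : ℕ} (S : Finset (Fin m)) (i : ℕ) : ℕ :=
  {b : Pt m | 2 ^ m - i + 1 ≤ Drev b ∧ ∀ k, b k = 1 → k ∈ S}.ncard

/-- The partial order ≼ on monomials (given by their index sets):
x_{i_1}…x_{i_t} ≼ x_{j_1}…x_{j_s} iff t ≤ s and i_{t-l} ≤ j_{s-l} for 0 ≤ l ≤ t-1. -/
def MonLE {m : ℕ} (S T : Finset (Fin m)) : Prop :=
  S.card ≤ T.card ∧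
    List.Forall₂ (· ≤ ·) (S.sort (· ≤ ·)) (List.drop (T.card - S.card) (T.sort (· ≤ ·)))

/-- Evaluation vector of the monomial with index set S. -/
def evMon {m : ℕ} (S : Finset (Fin m)) : BPoly m := fun a => ∏ i ∈ S, a i

/-- The monomial code C(ℐ): the 𝔽₂-span of the evaluation vectors of ℐ. -/
def Ccode {m : ℕ} (ℐ : Finset (Finset (Fin m))) : Submodule (ZMod 2) (BPoly m) :=
  Submodule.span (ZMod 2) (evMon '' (↑ℐ : Set (Finset (Fin m))))

/-- N_f(w,a) = |{p ∈ T(f) : wt(p_{[1,a]}) = w}|. -/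
noncomputable def Nfun {m : ℕ} (S : Finset (Fin m)) (w a : ℕ) : ℕ :=
  {p : BPoly m | p ∈ Tset S ∧ wtIn p 1 a = w}.ncard

/-- P_f(w,i) = |{p ∈ T(f) : wt(p_{[i+1,N]}) = w}|. -/
noncomputable def Pf {m : ℕ} (S : Finset (Fin m)) (w i : ℕ) : ℕ :=
  {p : BPoly m | p ∈ Tset S ∧ wtIn p (i + 1) (2 ^ m) = w}.ncard

theorem sum_add_sum_suppOf {m : ℕ} (w : Fin m → ℕ) (a : Pt m) :
    ∑ i, w i * (1 - (a i).val) + ∑ i ∈ suppOf a, w i = ∑ i, w i := by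
  rw [suppOf, Finset.sum_filter, ← Finset.sum_add_distrib]
  refine Finset.sum_congr rfl fun i _ => ?_
  have key : ∀ x : ZMod 2, x = 0 ∨ x = 1 := by decide
  rcases key (a i) with h | h <;> simp [h, ZMod.val_one]

theorem sum_sort_map {m : ℕ} (w : Fin m → ℕ) (S : Finset (Fin m)) :
    ((S.sort (· ≤ ·)).map w).sum = ∑ i ∈ S, w i := by
  rw [Finset.sum_eq_multiset_sum, ← Finset.sort_eq S (· ≤ ·), Multiset.map_coe,
    Multiset.sum_coe]

theorem sum_map_le_of_forall₂ {α : Type*} [Preorder α] {w : α → ℕ} (hw : Antitone w)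
    {l l' : List α} (h : List.Forall₂ (· ≤ ·) l l') : (l'.map w).sum ≤ (l.map w).sum := by
  induction h with
  | nil => simp
  | cons hxy _ ih =>
    simp only [List.map_cons, List.sum_cons]
    exact add_le_add (hw hxy) ih

/-- If g = x^b is a factor of f = x^a, or f and g have the same degree
and f ≼ g, then D(a_m,…,a_1) ≤ D(b_m,…,b_1), i.e.
Σ 2^{m-i}(1-a_i) ≤ Σ 2^{m-i}(1-b_i); hence g precedes f in the bit-reversal
shortening order. -/
theorem stmt0 (m : ℕ) (hm : 1 ≤ m) (a b : Pt m)
    (h : (∀ i, b i = 1 → a i = 1) ∨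
      ((suppOf a).card = (suppOf b).card ∧ MonLE (suppOf a) (suppOf b))) :
    ∑ i : Fin m, 2 ^ (m - 1 - (i : ℕ)) * (1 - (a i).val) ≤
      ∑ i : Fin m, 2 ^ (m - 1 - (i : ℕ)) * (1 - (b i).val) := by
  set w : Fin m → ℕ := fun i => 2 ^ (m - 1 - (i : ℕ)) with hw
  have hanti : Antitone w := fun i j hij =>
    Nat.pow_le_pow_right two_pos (Nat.sub_le_sub_left hij _)
  have hsum : ∑ i ∈ suppOf b, w i ≤ ∑ i ∈ suppOf a, w i := by
    rcases h with h | ⟨hcard, -, hle⟩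
    · exact Finset.sum_le_sum_of_subset fun i hi => by
        simp only [suppOf, Finset.mem_filter, Finset.mem_univ, true_and] at hi ⊢
        exact h i hi
    · rw [hcard, Nat.sub_self, List.drop_zero] at hle
      simpa only [sum_sort_map] using sum_map_le_of_forall₂ hanti hle
  have ha := sum_add_sum_suppOf w a
  have hb := sum_add_sum_suppOf w b
  simp only [hw] at ha hb hsum
  omega
end

section
/- Let f be a monomial of degree r and let g be the i-th shortened monomial in the bit-reversal shortening order (1 ≤ i ≤ N). If g is not a factor of f, then T_S^c(f, i−1) = T_S^c(f, i); that is, requiring in addition that the coefficient of g vanish removes no polynomial from T_S^c(f, i−1). -/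
open Finset

lemma ZMod.two_eq_zero_or_one (z : ZMod 2) : z = 0 ∨ z = 1 := by
  revert z
  decide

/-- `Drev` strictly decreases along the lexicographic order with coordinate `0` most significant. -/
lemma Drev_lt_of_lex {m : ℕ} {y b : Pt m} {k : Fin m} (hy : y k = 0) (hb : b k = 1)
    (h : ∀ i < k, y i = 1 → b i = 1) : Drev b < Drev y := by
  have htail : ∑ i ∈ univ.filter (fun i : Fin m => k < i), 2 ^ (m - 1 - (i : ℕ))
      < 2 ^ (m - 1 - (k : ℕ)) := by
    rw [← Finset.sum_image (f := fun n => 2 ^ n) (g := fun i : Fin m => m - 1 - (i : ℕ))]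
    · apply Nat.geomSum_lt le_rfl
      intro n hn
      simp only [mem_image, mem_filter, mem_univ, true_and] at hn
      obtain ⟨i, hi, rfl⟩ := hn
      have := i.isLt
      rw [Fin.lt_def] at hi
      omega
    · intro i _ j _ hij
      have := i.isLt
      have := j.isLt
      ext
      simp only at hij
      omega
  have key : ∀ i : Fin m, 2 ^ (m - 1 - (i : ℕ)) * (1 - (b i).val)
        + (if i = k then 2 ^ (m - 1 - (k : ℕ)) else 0)
      ≤ 2 ^ (m - 1 - (i : ℕ)) * (1 - (y i).val)
        + (if k < i then 2 ^ (m - 1 - (i : ℕ)) else 0) := by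
    intro i
    rcases lt_trichotomy i k with hik | rfl | hik
    · simp only [hik.ne, hik.not_gt, if_false, add_zero]
      rcases ZMod.two_eq_zero_or_one (y i) with h0 | h1
      · rw [h0, ZMod.val_zero]
        exact Nat.mul_le_mul_left _ (Nat.sub_le _ _)
      · rw [h i hik h1, h1]
    · simp [hy, hb, ZMod.val_one]
    · simp only [hik.ne', hik, if_true, if_false, add_zero]
      exact le_add_left (mul_le_of_le_one_right (Nat.zero_le _) (Nat.sub_le _ _))
  have hsum := Finset.sum_le_sum fun i (_ : i ∈ univ) => key i
  simp only [Finset.sum_add_distrib, Finset.sum_ite_eq', mem_univ, if_true,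
    ← Finset.sum_filter] at hsum
  unfold Drev
  omega

lemma Drev_injective {m : ℕ} : Function.Injective (Drev : Pt m → ℕ) := by
  intro y b hyb
  by_contra hne
  have hex : (univ.filter fun i => y i ≠ b i).Nonempty := by
    obtain ⟨i, hi⟩ := Function.ne_iff.mp hne
    exact ⟨i, by simpa using hi⟩
  set k := (univ.filter fun i => y i ≠ b i).min' hex with hk
  have hkne : y k ≠ b k := (mem_filter.mp (Finset.min'_mem _ hex)).2
  have heq : ∀ i < k, y i = b i := by
    intro i hi
    by_contra hib
    exact hi.not_ge (Finset.min'_le _ _ (by simpa using hib))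
  rcases ZMod.two_eq_zero_or_one (y k) with hy | hy <;>
    rcases ZMod.two_eq_zero_or_one (b k) with hb | hb
  · exact hkne (hy.trans hb.symm)
  · exact (Drev_lt_of_lex hy hb fun i hi h => heq i hi ▸ h).ne' hyb
  · exact (Drev_lt_of_lex hb hy fun i hi h => (heq i hi).symm ▸ h).ne hyb
  · exact hkne (hy.trans hb.symm)

lemma mem_suppOf {m : ℕ} {b : Pt m} {k : Fin m} : k ∈ suppOf b ↔ b k = 1 := by
  simp [suppOf]

lemma suppOf_injective {m : ℕ} : Function.Injective (suppOf : Pt m → Finset (Fin m)) := by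
  intro a b hab
  funext i
  have h : a i = 1 ↔ b i = 1 := by rw [← mem_suppOf, hab, mem_suppOf]
  rcases ZMod.two_eq_zero_or_one (a i) with ha | ha <;>
    rcases ZMod.two_eq_zero_or_one (b i) with hb | hb <;> simp_all

/-- If all coefficients of `p` on the submonomials of `y` vanish, then `p y = 0`. -/
lemma eval_eq_zero_of_coeff_eq_zero {m : ℕ} {p : BPoly m} (y : Pt m)
    (h : ∀ a : Pt m, suppOf a ⊆ suppOf y → coeff (suppOf a) p = 0) : p y = 0 := by
  induction hn : (suppOf y).card using Nat.strong_induction_on generalizing y with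
  | _ n ih =>
    have hy := h y (Finset.Subset.refl _)
    unfold coeff at hy
    rwa [Finset.sum_eq_single_of_mem y (by simp [mem_suppOf])] at hy
    intro a ha hay
    have hsub : suppOf a ⊆ suppOf y := fun i hi => (mem_filter.mp ha).2 i (mem_suppOf.mp hi)
    have hlt : (suppOf a).card < n := by
      rw [← hn]
      exact Finset.card_lt_card (hsub.ssubset_of_ne fun he => hay (suppOf_injective he))
    exact ih _ hlt a (fun a' ha' => h a' (ha'.trans hsub)) rfl

/-- For `k ∉ S`, each member of `Tset S` is invariant under translation by some vector whose
first nonzero coordinate is `k`. -/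
lemma exists_period_of_mem_Tset {m : ℕ} {S : Finset (Fin m)} {p : BPoly m} (hp : p ∈ Tset S)
    {k : Fin m} (hk : k ∉ S) :
    ∃ v : Pt m, v k = 1 ∧ (∀ i < k, v i = 0) ∧ ∀ a, p (a + v) = p a := by
  obtain ⟨c, c0, rfl⟩ := hp
  let v : Pt m := fun i => if i = k then 1 else if i ∈ S ∧ k < i then c i k else 0
  refine ⟨v, by simp [v], fun i hi => by simp [v, hi.ne, hi.not_gt], fun a => ?_⟩
  refine Finset.prod_congr rfl fun j hj => ?_
  have hjk : j ≠ k := fun h => hk (h ▸ hj)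
  have hv : ∑ l ∈ univ.filter (fun l => l < j ∧ l ∉ S), c j l * v l = v j := by
    have hterm : ∀ l ∈ univ.filter (fun l => l < j ∧ l ∉ S),
        c j l * v l = if l = k then c j k else 0 := by
      intro l hl
      have hlS := (mem_filter.mp hl).2.2
      by_cases hlk : l = k <;> simp [v, hlk, hlS]
    rw [Finset.sum_congr rfl hterm, Finset.sum_ite_eq']
    simp [v, hjk, hj, hk]
  simp only [Pi.add_apply, mul_add, Finset.sum_add_distrib, hv]
  linear_combination CharTwo.add_self_eq_zero (v j)

/-- If `b` is not a factor of the monomial of `S` and the coefficients of `p ∈ Tset S` vanish on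
all monomials preceding `b` in the shortening order, then so does the coefficient on `b`. -/
lemma coeff_eq_zero_of_not_factor {m : ℕ} {S : Finset (Fin m)} {p : BPoly m} (hp : p ∈ Tset S)
    {b : Pt m} {k : Fin m} (hbk : b k = 1) (hkS : k ∉ S)
    (h : ∀ b' : Pt m, Drev b < Drev b' → coeff (suppOf b') p = 0) :
    coeff (suppOf b) p = 0 := by
  have hzero : ∀ y : Pt m, y k = 0 → (∀ i < k, y i = 1 → b i = 1) → p y = 0 := by
    intro y hyk hyb
    refine eval_eq_zero_of_coeff_eq_zero y fun a ha => h a ?_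
    have ha' : ∀ i, a i = 1 → y i = 1 := fun i hi => mem_suppOf.mp (ha (mem_suppOf.mpr hi))
    refine Drev_lt_of_lex (k := k) ?_ hbk fun i hi hai => hyb i hi (ha' i hai)
    refine (ZMod.two_eq_zero_or_one (a k)).resolve_right fun hak => ?_
    exact zero_ne_one (hyk.symm.trans (ha' k hak))
  obtain ⟨v, hvk, hv, hper⟩ := exists_period_of_mem_Tset hp hkS
  refine Finset.sum_eq_zero fun a ha => ?_
  have hab : ∀ i, a i = 1 → b i = 1 := fun i hi => mem_suppOf.mp ((mem_filter.mp ha).2 i hi)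
  rcases ZMod.two_eq_zero_or_one (a k) with hak | hak
  · exact hzero a hak fun i _ => hab i
  · rw [← hper a]
    refine hzero (a + v) ?_ fun i hi hi1 => hab i ?_
    · simp [hak, hvk, CharTwo.add_self_eq_zero]
    · simpa [hv i hi] using hi1

/-- if the i-th shortened monomial g (bit-reversal order) is not a
factor of f, then T_S^c(f, i-1) = T_S^c(f, i). -/
theorem stmt1 (m r : ℕ) (hm : 1 ≤ m) (S : Finset (Fin m)) (hS : S.card = r)
    (i : ℕ) (hi1 : 1 ≤ i) (hiN : i ≤ 2 ^ m) (b : Pt m)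
    (hb : Drev b = 2 ^ m - i + 1)
    (hfac : ¬ (∀ k, b k = 1 → k ∈ S)) :
    TSc S (i - 1) = TSc S i := by
  push Not at hfac
  obtain ⟨k, hbk, hkS⟩ := hfac
  ext p
  refine ⟨fun ⟨hp, h⟩ => ⟨hp, fun b' hb' => ?_⟩, fun ⟨hp, h⟩ => ⟨hp, fun b' hb' => ?_⟩⟩
  · rcases hb'.eq_or_lt with heq | hlt
    · rw [← Drev_injective (hb.trans heq)]
      exact coeff_eq_zero_of_not_factor hp hbk hkS fun b'' hb'' => h b'' (by omega)
    · exact h b' (by omega)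
  · exact h b' (by omega)
end

section
/- Let f be a monomial of degree r and 0 ≤ i ≤ N. Let β_f(i) be the number of monomials among the first i shortened monomials (in the bit-reversal shortening order) that are factors of f. Then the number of p ∈ T(f) whose evaluation vector vanishes on every position of Y'_i equals λ_f · (2^r − β_f(i)) / 2^r. -/
open Finset

lemma zmod_two_val_le_one (x : ZMod 2) : x.val ≤ 1 := by
  revert x; decide

lemma zmod_two_eq_one_of_ne_zero {x : ZMod 2} (h : x ≠ 0) : x = 1 := by
  revert x; decide

lemma zmod_two_add_eq_one_iff (x y : ZMod 2) : x + y = 1 ↔ x = 1 + y := by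
  revert x y; decide

lemma Dnat_succ {m : ℕ} (a : Pt (m + 1)) :
    Dnat a = (1 - (a 0).val) + 2 * (Dnat (Fin.tail a) - 1) + 1 := by
  simp only [Dnat, Fin.sum_univ_succ, Fin.tail, Nat.add_sub_cancel, Finset.mul_sum, Fin.val_succ,
    Fin.val_zero, pow_zero, one_mul, pow_succ]
  congr 2
  exact Finset.sum_congr rfl fun _ _ => by ring

lemma Dnat_injective (m : ℕ) : Function.Injective (Dnat : Pt m → ℕ) := by
  induction m with
  | zero => intro a b _; exact Subsingleton.elim _ _
  | succ m ih =>
    intro a b h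
    rw [Dnat_succ, Dnat_succ] at h
    have ha := zmod_two_val_le_one (a 0)
    have hb := zmod_two_val_le_one (b 0)
    have ha' : 1 ≤ Dnat (Fin.tail a) := Nat.le_add_left _ _
    have hb' : 1 ≤ Dnat (Fin.tail b) := Nat.le_add_left _ _
    have h0 : a 0 = b 0 := ZMod.val_injective 2 (by omega)
    have ht : Fin.tail a = Fin.tail b := ih (by omega)
    rw [← Fin.cons_self_tail a, ← Fin.cons_self_tail b, h0, ht]

lemma Drev_succ {m : ℕ} (a : Pt (m + 1)) :
    Drev a = 2 ^ m * (1 - (a 0).val) + Drev (Fin.tail a) := by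
  simp only [Drev, Fin.sum_univ_succ, Fin.tail, Fin.val_succ, Fin.val_zero, ← add_assoc]
  congr 2
  exact Finset.sum_congr rfl fun i _ => by
    rw [show m + 1 - 1 - ((i : ℕ) + 1) = m - 1 - i by omega]

lemma Drev_le {m : ℕ} (a : Pt m) : Drev a ≤ 2 ^ m := by
  induction m with
  | zero => simp [Drev]
  | succ m ih =>
    rw [Drev_succ, pow_succ, mul_two]
    exact add_le_add (mul_le_of_le_one_right (Nat.zero_le _) (Nat.sub_le _ _)) (ih _)

/-- `Drev` is antitone for the lexicographic order, stated at the first differing coordinate. -/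
lemma Drev_le_of_lex {m : ℕ} {b c : Pt m} (k : Fin m) (h : ∀ i < k, b i = c i)
    (hb : b k = 1) (hc : c k = 0) : Drev b ≤ Drev c := by
  induction m with
  | zero => exact k.elim0
  | succ m ih =>
    rw [Drev_succ, Drev_succ]
    induction k using Fin.cases with
    | zero =>
      have h1 := Drev_le (Fin.tail b)
      rw [hb, hc, ZMod.val_zero, show (1 : ZMod 2).val = 1 from rfl]
      omega
    | succ k =>
      rw [h 0 (Fin.succ_pos k)]
      exact Nat.add_le_add_left
        (ih k (fun i hi => h i.succ (Fin.succ_lt_succ_iff.2 hi)) hb hc) _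

/-- The linear coefficients parametrizing `Tset S`. -/
abbrev LinCoeffs {m : ℕ} (S : Finset (Fin m)) :=
  ∀ j : S, {k : Fin m // k < j ∧ k ∉ S} → ZMod 2

/-- The member of `Tset S` with given linear and constant coefficients. -/
def ofCoeffs {m : ℕ} (S : Finset (Fin m)) (q : LinCoeffs S × (S → ZMod 2)) : BPoly m :=
  fun x => ∏ j : S, (x j + (∑ k, q.1 j k * x k) + q.2 j)

/-- The point supported in `S` at which `ofCoeffs S (d, e)` takes the value one. -/
def minPt {m : ℕ} (S : Finset (Fin m)) (e : S → ZMod 2) : Pt m :=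
  fun k => if h : k ∈ S then 1 + e ⟨k, h⟩ else 0

lemma range_ofCoeffs {m : ℕ} (S : Finset (Fin m)) : Set.range (ofCoeffs S) = Tset S := by
  ext p
  constructor
  · rintro ⟨⟨d, e⟩, rfl⟩
    refine ⟨fun j k => if h : j ∈ S then if h' : k < j ∧ k ∉ S then d ⟨j, h⟩ ⟨k, h'⟩ else 0 else 0,
      fun j => if h : j ∈ S then e ⟨j, h⟩ else 0, ?_⟩
    funext x
    simp only [ofCoeffs]
    rw [← Finset.prod_coe_sort S]
    refine Finset.prod_congr rfl fun j _ => ?_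
    rw [Finset.sum_subtype (p := fun k => k < (j : Fin m) ∧ k ∉ S) (F := inferInstance) _
      (by simp)]
    have hs : ∀ k : {k : Fin m // k < (j : Fin m) ∧ k ∉ S},
        (k : Fin m) < j ∧ (k : Fin m) ∉ S := fun k => k.2
    simp [hs]
  · rintro ⟨c, c0, rfl⟩
    refine ⟨(fun j k => c j k, fun j => c0 j), ?_⟩
    funext x
    simp only [ofCoeffs]
    rw [← Finset.prod_coe_sort S]
    refine Finset.prod_congr rfl fun j _ => ?_
    rw [Finset.sum_subtype (p := fun k => k < (j : Fin m) ∧ k ∉ S) _ (by simp)]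

lemma ofCoeffs_ne_zero_iff {m : ℕ} (S : Finset (Fin m)) (d : LinCoeffs S) (e : S → ZMod 2)
    (x : Pt m) :
    ofCoeffs S (d, e) x ≠ 0 ↔ ∀ j : S, x j = 1 + ((∑ k, d j k * x k) + e j) := by
  simp only [ofCoeffs, Finset.prod_ne_zero_iff, Finset.mem_univ, true_imp_iff,
    ← zmod_two_add_eq_one_iff, add_assoc]
  exact forall_congr' fun j =>
    ⟨zmod_two_eq_one_of_ne_zero, fun h => by rw [h]; exact one_ne_zero⟩

lemma affine_eq_of_ofCoeffs_eq {m : ℕ} (S : Finset (Fin m)) {d d' : LinCoeffs S}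
    {e e' : S → ZMod 2} (h : ofCoeffs S (d, e) = ofCoeffs S (d', e')) (y : Pt m) (j : S) :
    (∑ k, d j k * y k) + e j = (∑ k, d' j k * y k) + e' j := by
  let x : Pt m := fun i => if hi : i ∈ S then 1 + ((∑ k, d ⟨i, hi⟩ k * y k) + e ⟨i, hi⟩) else y i
  have hxS : ∀ j : S, x j = 1 + ((∑ k, d j k * y k) + e j) := fun j => by simp [x]
  have hxN : ∀ (j : S) (k : {k : Fin m // k < j ∧ k ∉ S}), x k = y k := fun j k => by
    simp [x, k.2.2]
  have h1 : ofCoeffs S (d, e) x ≠ 0 := by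
    rw [ofCoeffs_ne_zero_iff]
    intro j
    simp only [hxN, hxS]
  rw [h, ofCoeffs_ne_zero_iff] at h1
  have h2 := h1 j
  simp only [hxN, hxS] at h2
  exact add_left_cancel h2

lemma ofCoeffs_injective {m : ℕ} (S : Finset (Fin m)) : Function.Injective (ofCoeffs S) := by
  rintro ⟨d, e⟩ ⟨d', e'⟩ h
  have key := affine_eq_of_ofCoeffs_eq S h
  have he : e = e' := funext fun j => by simpa using key 0 j
  subst he
  have hd : d = d' := by
    funext j k
    have := add_right_cancel (key (Pi.single (k : Fin m) 1) j)
    simpa [Pi.single_apply, Subtype.coe_inj] using this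
  rw [hd]

lemma ofCoeffs_minPt_ne_zero {m : ℕ} (S : Finset (Fin m)) (d : LinCoeffs S) (e : S → ZMod 2) :
    ofCoeffs S (d, e) (minPt S e) ≠ 0 := by
  rw [ofCoeffs_ne_zero_iff]
  intro j
  have h0 : ∀ k : {k : Fin m // k < (j : Fin m) ∧ k ∉ S}, minPt S e k = 0 := fun k => by
    simp [minPt, k.2.2]
  simp only [h0]
  simp [minPt]

lemma Drev_le_Drev_minPt {m : ℕ} (S : Finset (Fin m)) (d : LinCoeffs S) (e : S → ZMod 2)
    {b : Pt m} (hb : ofCoeffs S (d, e) b ≠ 0) : Drev b ≤ Drev (minPt S e) := by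
  by_cases hne : b = minPt S e
  · rw [hne]
  have hex : ∃ k, b k ≠ minPt S e k := Function.ne_iff.1 hne
  obtain ⟨k, hk, hmin⟩ := WellFounded.has_min (wellFounded_lt (α := Fin m))
    {k | b k ≠ minPt S e k} hex
  have hlt : ∀ i < k, b i = minPt S e i := fun i hi => by
    by_contra hc
    exact hmin i hc hi
  have hkS : k ∉ S := by
    intro hS
    refine hk ?_
    rw [ofCoeffs_ne_zero_iff] at hb
    have h0 : ∀ l : {l : Fin m // l < k ∧ l ∉ S}, b l = 0 := fun l => by
      rw [hlt l l.2.1]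
      simp [minPt, l.2.2]
    have h1 := hb ⟨k, hS⟩
    simp only [h0] at h1
    rw [h1]
    simp [minPt, hS]
  have hk0 : minPt S e k = 0 := by simp [minPt, hkS]
  rw [Set.mem_ofPred_eq, hk0] at hk
  exact Drev_le_of_lex k hlt (zmod_two_eq_one_of_ne_zero hk) hk0

lemma ofCoeffs_vanishes_iff {m : ℕ} (S : Finset (Fin m)) (n : ℕ) (d : LinCoeffs S)
    (e : S → ZMod 2) :
    (∀ a : Pt m, (∃ b : Pt m, n ≤ Drev b ∧ Dnat a = Dnat b) → ofCoeffs S (d, e) a = 0) ↔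
      ¬ n ≤ Drev (minPt S e) := by
  constructor
  · intro h hn
    exact ofCoeffs_minPt_ne_zero S d e (h _ ⟨_, hn, rfl⟩)
  · rintro h a ⟨b, hb, hab⟩
    obtain rfl := Dnat_injective m hab
    by_contra hne
    exact h (hb.trans (Drev_le_Drev_minPt S d e hne))

lemma minPt_injective {m : ℕ} (S : Finset (Fin m)) : Function.Injective (minPt S) := by
  intro e e' h
  funext j
  simpa [minPt] using congrFun h j

lemma betaf_eq_ncard {m : ℕ} (S : Finset (Fin m)) (i : ℕ) :
    betaf S i = {e : S → ZMod 2 | 2 ^ m - i + 1 ≤ Drev (minPt S e)}.ncard := by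
  rw [betaf, ← Set.ncard_image_of_injective _ (minPt_injective S)]
  congr 1
  ext b
  constructor
  · rintro ⟨h, hb⟩
    have hbe : minPt S (fun j => 1 + b j) = b := by
      funext k
      by_cases hk : k ∈ S
      · simp only [minPt, hk, dif_pos]
        rw [← add_assoc, CharTwo.add_self_eq_zero, zero_add]
      · simp only [minPt, hk, dif_neg, not_false_eq_true]
        by_contra hne
        exact hk (hb k (zmod_two_eq_one_of_ne_zero (Ne.symm hne)))
    exact ⟨fun j => 1 + b j, by rwa [Set.mem_ofPred_eq, hbe], hbe⟩
  · rintro ⟨e, he, rfl⟩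
    refine ⟨he, fun k hk => ?_⟩
    by_contra hkS
    simp [minPt, hkS] at hk

lemma card_lt_notMem {m : ℕ} (S : Finset (Fin m)) (t : Fin S.card) :
    Fintype.card {k : Fin m // k < (S.orderIsoOfFin rfl t : Fin m) ∧ k ∉ S} =
      ((S.orderIsoOfFin rfl t : Fin m) : ℕ) - (t : ℕ) := by
  set j : Fin m := (S.orderIsoOfFin rfl t : Fin m)
  have hmem : ((Finset.Iio j).filter (· ∈ S)).card = t := by
    have him : (Finset.Iio j).filter (· ∈ S) =
        (Finset.Iio t).map (S.orderEmbOfFin rfl).toEmbedding := by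
      ext k
      simp only [Finset.mem_filter, Finset.mem_Iio, Finset.mem_map]
      constructor
      · rintro ⟨hk, hkS⟩
        refine ⟨(S.orderIsoOfFin rfl).symm ⟨k, hkS⟩, ?_, ?_⟩
        · rw [OrderIso.symm_apply_lt]
          exact hk
        · simp [← Finset.coe_orderIsoOfFin_apply]
      · rintro ⟨s, hs, rfl⟩
        exact ⟨(S.orderEmbOfFin rfl).strictMono hs, S.orderEmbOfFin_mem rfl s⟩
    rw [him, Finset.card_map, Fin.card_Iio]
  have hsplit := Finset.card_filter_add_card_filter_not (s := Finset.Iio j) (· ∈ S)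
  rw [hmem, Fin.card_Iio] at hsplit
  rw [Fintype.card_of_subtype ((Finset.Iio j).filter (· ∉ S)) (by simp)]
  omega

lemma lam_eq {m : ℕ} (S : Finset (Fin m)) :
    lam S = Nat.card (LinCoeffs S) * 2 ^ S.card := by
  have hcard : Nat.card (LinCoeffs S) =
      2 ^ ∑ t : Fin S.card, (((S.orderIsoOfFin rfl t : Fin m) : ℕ) - (t : ℕ)) := by
    rw [Nat.card_eq_fintype_card, Fintype.card_pi, ← Finset.prod_pow_eq_pow_sum,
      ← Equiv.prod_comp (S.orderIsoOfFin rfl).toEquiv]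
    refine Finset.prod_congr rfl fun t _ => ?_
    rw [Fintype.card_fun, ZMod.card, ← card_lt_notMem]
    rfl
  rw [hcard, ← pow_add, lam, Finset.sum_add_distrib]
  simp

/-- for a monomial f of degree r and 0 ≤ i ≤ N, the number of
p ∈ T(f) whose evaluation vector vanishes on every position of the bit-reversal
shortening pattern Y'_i equals λ_f · (2^r − β_f(i)) / 2^r.
(A position n belongs to Y'_i iff n = Dnat b for some monomial b among the
first i shortened, i.e. with Drev b ≥ 2^m − i + 1.) -/
theorem stmt3 (m r : ℕ) (hm : 1 ≤ m) (S : Finset (Fin m)) (hS : S.card = r)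
    (i : ℕ) (hi : i ≤ 2 ^ m) :
    {p : BPoly m | p ∈ Tset S ∧
        ∀ a : Pt m, (∃ b : Pt m, 2 ^ m - i + 1 ≤ Drev b ∧ Dnat a = Dnat b) →
          p a = 0}.ncard
      = lam S * (2 ^ r - betaf S i) / 2 ^ r := by
  subst hS
  have hset : {p : BPoly m | p ∈ Tset S ∧
      ∀ a : Pt m, (∃ b : Pt m, 2 ^ m - i + 1 ≤ Drev b ∧ Dnat a = Dnat b) → p a = 0} =
      ofCoeffs S '' ((Set.univ : Set (LinCoeffs S)) ×ˢ
        {e : S → ZMod 2 | 2 ^ m - i + 1 ≤ Drev (minPt S e)}ᶜ) := by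
    ext p
    rw [← range_ofCoeffs]
    constructor
    · rintro ⟨⟨⟨d, e⟩, rfl⟩, hp⟩
      exact ⟨(d, e), ⟨trivial, (ofCoeffs_vanishes_iff S _ d e).1 hp⟩, rfl⟩
    · rintro ⟨⟨d, e⟩, ⟨-, he⟩, rfl⟩
      exact ⟨⟨(d, e), rfl⟩, (ofCoeffs_vanishes_iff S _ d e).2 he⟩
  rw [hset, Set.ncard_image_of_injective _ (ofCoeffs_injective S), Set.ncard_prod, Set.ncard_univ,
    Set.ncard_compl, ← betaf_eq_ncard, lam_eq, mul_right_comm, Nat.mul_div_cancel _ (by positivity)]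
  simp
end

section
/- Let f = x_{i_1}⋯x_{i_t} with 1 ≤ i_1 < ⋯ < i_t ≤ m and let p ∈ T(f). Then: (i) ev(p)_l = ev(p)_{l + 2^{i_t}} for every 1 ≤ l ≤ 2^m − 2^{i_t}; and (ii) for every 1 ≤ s ≤ 2^m − 2^{i_t} + 1, the Hamming weight of the window p_{[s, s+2^{i_t}−1]} equals wt(p)/2^{m−i_t} = 2^{i_t − t}. -/
open Finset

/-- Points solving `x j = g j x` for `j ∈ S`, where each `g j` only depends on the coordinates
outside `S`, are determined by their free coordinates outside `S`. -/
theorem card_filter_eq_of_free_coords {ι R : Type*} [Fintype ι] [DecidableEq ι] [Fintype R]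
    [DecidableEq R] [Inhabited R] (S : Finset ι) (g : ι → (ι → R) → R)
    (hg : ∀ j ∈ S, ∀ x y : ι → R, (∀ k ∉ S, x k = y k) → g j x = g j y) :
    #{x : ι → R | ∀ j ∈ S, x j = g j x} = Fintype.card R ^ (Fintype.card ι - #S) := by
  have hcard : Fintype.card ({k // k ∉ S} → R) =
      Fintype.card R ^ (Fintype.card ι - #S) := by
    rw [Fintype.card_fun, Fintype.card_subtype_compl, Fintype.card_coe]
  rw [← hcard, ← Finset.card_univ]
  refine Finset.card_bij (fun x _ k => x k.1) (fun _ _ => mem_univ _) ?_ ?_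
  · intro x hx y hy hxy
    simp only [mem_filter, mem_univ, true_and] at hx hy
    have hoff : ∀ k ∉ S, x k = y k := fun k hk => congrFun hxy ⟨k, hk⟩
    funext k
    by_cases hk : k ∈ S
    · rw [hx k hk, hy k hk, hg k hk x y hoff]
    · exact hoff k hk
  · intro y _
    let e : ι → R := fun k => if h : k ∉ S then y ⟨k, h⟩ else default
    let x : ι → R := fun k => if k ∈ S then g k e else e k
    refine ⟨x, ?_, ?_⟩
    · simp only [mem_filter, mem_univ, true_and]
      intro j hj
      rw [hg j hj x e fun k hk => if_neg hk]
      exact if_pos hj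
    · funext k
      simp [x, e, k.2]

theorem wt_of_mem_Tset {m : ℕ} {S : Finset (Fin m)} {p : BPoly m} (hp : p ∈ Tset S) :
    wt p = 2 ^ (m - #S) := by
  obtain ⟨c, c0, rfl⟩ := hp
  have key := card_filter_eq_of_free_coords S
    (fun j (x : Pt m) =>
      1 + (∑ k ∈ univ.filter (fun k => k < j ∧ k ∉ S), c j k * x k) + c0 j) (by
    intro j _ x y hxy
    rw [Finset.sum_congr rfl fun k hk => by rw [hxy k (mem_filter.mp hk).2.2]])
  rw [ZMod.card, Fintype.card_fin] at key
  rw [← key, wt]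
  congr 1
  ext x
  have hprod : ∀ f : Fin m → ZMod 2, ∏ j ∈ S, f j = 1 ↔ ∀ j ∈ S, f j = 1 := by
    intro f
    refine ⟨fun h j hj => ?_, Finset.prod_eq_one⟩
    have h0 : f j ≠ 0 := fun h0 => by simp [Finset.prod_eq_zero hj h0] at h
    revert h0
    generalize f j = u
    decide +revert
  have hbit : ∀ u v w : ZMod 2, u + v + w = 1 ↔ u = 1 + v + w := by decide
  simp only [mem_filter, mem_univ, true_and, hprod, hbit]

/-- Members of `Tset S` only depend on the coordinates up to the largest element of `S`. -/
theorem eq_of_mem_Tset_of_eq_below {m M : ℕ} {S : Finset (Fin m)} {p : BPoly m} (hp : p ∈ Tset S)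
    (hM : ∀ j ∈ S, (j : ℕ) < M) {a b : Pt m} (hab : ∀ i : Fin m, (i : ℕ) < M → a i = b i) :
    p a = p b := by
  obtain ⟨c, c0, rfl⟩ := hp
  refine Finset.prod_congr rfl fun j hj => ?_
  rw [hab j (hM j hj), Finset.sum_congr rfl fun k hk => by
    rw [hab k (lt_trans (mem_filter.mp hk).2.1 (hM j hj))]]

theorem Dnat_eq_ofBits {m : ℕ} (a : Pt m) :
    Dnat a = Nat.ofBits (fun i => decide (a i = 0)) + 1 := by
  rw [Dnat, add_left_inj]
  induction m with
  | zero => simp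
  | succ m ih =>
    have hbit : ∀ u : ZMod 2, 1 - u.val = (decide (u = 0)).toNat := by decide
    rw [Fin.sum_univ_succ, Nat.ofBits_succ]
    have := ih (fun i => a i.succ)
    simp only [Function.comp_def, ← this, Fin.val_succ, pow_succ, Finset.mul_sum, hbit]
    simp [mul_comm, mul_assoc, add_comm]

/-- The point at position `n + 1` of the evaluation vector, for `n < 2 ^ m`. -/
def ptOfNat (m n : ℕ) : Pt m := fun i => if n.testBit i then 0 else 1

theorem ptOfNat_Dnat_sub_one {m : ℕ} (a : Pt m) : ptOfNat m (Dnat a - 1) = a := by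
  funext i
  have hbit : ∀ u : ZMod 2, (if u = 0 then (0 : ZMod 2) else 1) = u := by decide
  simp [ptOfNat, Dnat_eq_ofBits, hbit]

theorem Dnat_ptOfNat {m n : ℕ} (hn : n < 2 ^ m) : Dnat (ptOfNat m n) = n + 1 := by
  rw [Dnat_eq_ofBits, add_left_inj]
  simp [ptOfNat, Nat.ofBits_testBit, Nat.mod_eq_of_lt hn]

theorem Dnat_le {m : ℕ} (a : Pt m) : Dnat a ≤ 2 ^ m := by
  rw [Dnat_eq_ofBits]
  exact Nat.ofBits_lt_two_pow _

theorem wtIn_eq_card_filter_Ico {m : ℕ} (p : BPoly m) {u v : ℕ} (hv : v ≤ 2 ^ m) :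
    wtIn p (u + 1) v = #{n ∈ Ico u v | p (ptOfNat m n) = 1} := by
  refine Finset.card_nbij' (fun a => Dnat a - 1) (ptOfNat m) ?_ ?_ ?_ ?_
  · intro a ha
    simp only [coe_filter, mem_univ, true_and, Set.mem_ofPred_eq] at ha
    simp only [coe_filter, mem_Ico, Set.mem_ofPred_eq, ptOfNat_Dnat_sub_one]
    exact ⟨by omega, ha.2.2⟩
  · intro n hn
    simp only [coe_filter, mem_Ico, Set.mem_ofPred_eq] at hn
    simp only [coe_filter, mem_univ, true_and, Set.mem_ofPred_eq,
      Dnat_ptOfNat (hn.1.2.trans_le hv)]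
    exact ⟨by omega, by omega, hn.2⟩
  · intro a _
    exact ptOfNat_Dnat_sub_one a
  · intro n hn
    simp only [coe_filter, mem_Ico, Set.mem_ofPred_eq] at hn
    simp [Dnat_ptOfNat (hn.1.2.trans_le hv)]

theorem wt_eq_wtIn {m : ℕ} (p : BPoly m) : wt p = wtIn p 1 (2 ^ m) := by
  rw [wt, wtIn]
  congr 1
  ext a
  have h : 1 ≤ Dnat a := Nat.le_add_left 1 _
  simp [h, Dnat_le a]

theorem Nat.count_mul_of_periodic {P : ℕ → Prop} [DecidablePred P] {a : ℕ}
    (hP : Function.Periodic P a) (k : ℕ) : (a * k).count P = a.count P * k := by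
  induction k with
  | zero => simp
  | succ k ih =>
    have h : (fun n => P (a * k + n)) = P := by
      funext n
      rw [add_comm, mul_comm]
      exact hP.nat_mul k n
    rw [Nat.mul_succ, Nat.count_add, ih, Nat.mul_succ]
    simp only [h]

theorem periodic_ptOfNat_of_mem_Tset {m M : ℕ} {S : Finset (Fin m)} {p : BPoly m}
    (hp : p ∈ Tset S) (hM : ∀ j ∈ S, (j : ℕ) < M) :
    Function.Periodic (fun n => p (ptOfNat m n)) (2 ^ M) := by
  intro n
  refine eq_of_mem_Tset_of_eq_below hp hM fun i hi => ?_
  rw [ptOfNat, ptOfNat, add_comm, Nat.testBit_two_pow_add_gt hi]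

/-- for f = x_{i_1}⋯x_{i_t} (index set S, largest 1-based index
i_t = max S + 1) and p ∈ T(f):
(i) ev(p)_l = ev(p)_{l + 2^{i_t}} whenever both positions are valid;
(ii) every window of length 2^{i_t} has weight wt(p)/2^{m-i_t} = 2^{i_t - t}. -/
theorem stmt5 (m : ℕ) (hm : 1 ≤ m) (S : Finset (Fin m)) (hne : S.Nonempty)
    (p : BPoly m) (hp : p ∈ Tset S) :
    (∀ a b : Pt m, Dnat b = Dnat a + 2 ^ ((S.max' hne : ℕ) + 1) → p a = p b) ∧
    (∀ s : ℕ, 1 ≤ s → s ≤ 2 ^ m - 2 ^ ((S.max' hne : ℕ) + 1) + 1 →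
      wtIn p s (s + 2 ^ ((S.max' hne : ℕ) + 1) - 1)
          = wt p / 2 ^ (m - ((S.max' hne : ℕ) + 1)) ∧
        wt p / 2 ^ (m - ((S.max' hne : ℕ) + 1)) = 2 ^ ((S.max' hne : ℕ) + 1 - S.card)) := by
  have hM : ∀ j ∈ S, (j : ℕ) < (S.max' hne : ℕ) + 1 := fun j hj =>
    Nat.lt_succ_of_le (S.le_max' j hj)
  have hMm : (S.max' hne : ℕ) + 1 ≤ m := (S.max' hne).isLt
  generalize (S.max' hne : ℕ) + 1 = M at *
  have hper := periodic_ptOfNat_of_mem_Tset hp hM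
  have hper' : Function.Periodic (fun n => p (ptOfNat m n) = 1) (2 ^ M) := fun n =>
    congrArg (· = 1) (hper n)
  have hcard : #S ≤ M := by
    simpa using Finset.card_le_card_of_injOn (t := range M) (fun j : Fin m => (j : ℕ))
      (fun j hj => by simpa using hM j hj) Fin.val_injective.injOn
  have hpow : 2 ^ m = 2 ^ M * 2 ^ (m - M) := by rw [← pow_add, Nat.add_sub_cancel' hMm]
  refine ⟨fun a b hab => ?_, fun s hs hs' => ⟨?_, ?_⟩⟩
  · have h1 : 1 ≤ Dnat a := Nat.le_add_left 1 _
    have hb : Dnat b - 1 = Dnat a - 1 + 2 ^ M := by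
      rw [hab, Nat.sub_add_comm h1]
    rw [← ptOfNat_Dnat_sub_one a, ← ptOfNat_Dnat_sub_one b, hb]
    exact (hper _).symm
  · obtain ⟨u, rfl⟩ := Nat.exists_eq_add_of_le' hs
    have hle : 2 ^ M ≤ 2 ^ m := Nat.pow_le_pow_right two_pos hMm
    have hend : u + 1 + 2 ^ M - 1 = u + 2 ^ M := by rw [add_right_comm, Nat.add_sub_cancel]
    have hle' : u + 2 ^ M ≤ 2 ^ m := Nat.add_le_of_le_sub hle (Nat.le_of_succ_le_succ hs')
    have hwt : wt p = (2 ^ M).count (fun n => p (ptOfNat m n) = 1) * 2 ^ (m - M) := by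
      rw [wt_eq_wtIn, ← zero_add 1, wtIn_eq_card_filter_Ico p le_rfl, ← Finset.range_eq_Ico,
        ← Nat.count_eq_card_filter_range, hpow, Nat.count_mul_of_periodic hper']
    rw [hend, wtIn_eq_card_filter_Ico p hle',
      Nat.filter_Ico_card_eq_of_periodic _ _ _ hper', hwt,
      Nat.mul_div_cancel _ (Nat.two_pow_pos _)]
  · rw [wt_of_mem_Tset hp, Nat.pow_div (by omega) two_pos]
    congr 1
    omega
end

section
/- Let f = x_{i_1}⋯x_{i_t} with 1 ≤ i_1 < ⋯ < i_t ≤ m and t ≥ 2. Let f^{(0)} := x_{i_1}⋯x_{i_{t−1}}, and for s ∈ B(f,t) let f^{(s)} be the degree-t monomial with index set {i_1,…,i_{t−1}, s} and α_f(s) := |{1 ≤ j ≤ t−1 : i_j > s}|. Then for every 0 ≤ a ≤ 2^{i_t−1} and every integer w ≥ 1: N_f(w,a) = Σ_{s∈B(f,t)} 2^{α_f(s)} · N_{f^{(s)}}(w,a) + N_{f^{(0)}}(w,a). -/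
open Finset

/-- The coefficient matrices parametrising `Tset S`: row `j ∈ S` holds the coefficients of the
linear form attached to `j`, and its diagonal entry holds the constant term. -/
def coeffMats {m : ℕ} (S : Finset (Fin m)) : Finset (Fin m → Fin m → ZMod 2) :=
  Finset.univ.filter (fun c => ∀ j k, c j k ≠ 0 → j ∈ S ∧ (k = j ∨ (k < j ∧ k ∉ S)))

/-- The affine form `x_j + ∑_{k<j} r_k x_k + r_j`. -/
def affForm {m : ℕ} (j : Fin m) (r : Fin m → ZMod 2) : BPoly m :=
  fun x => x j + (∑ k ∈ Finset.Iio j, r k * x k) + r j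

/-- The product of the affine forms attached to the rows of `c` in `S`. -/
def matPoly {m : ℕ} (S : Finset (Fin m)) (c : Fin m → Fin m → ZMod 2) : BPoly m :=
  fun x => ∏ j ∈ S, affForm j (c j) x

lemma zmod_two_eq_zero_or_one (x : ZMod 2) : x = 0 ∨ x = 1 := by
  revert x; decide

lemma mem_coeffMats {m : ℕ} {S : Finset (Fin m)} {c : Fin m → Fin m → ZMod 2} :
    c ∈ coeffMats S ↔ ∀ j k, c j k ≠ 0 → j ∈ S ∧ (k = j ∨ (k < j ∧ k ∉ S)) := by
  simp [coeffMats]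

lemma affForm_eq {m : ℕ} {S : Finset (Fin m)} {c : Fin m → Fin m → ZMod 2}
    (hc : c ∈ coeffMats S) (j : Fin m) (x : Pt m) :
    affForm j (c j) x =
      x j + (∑ k ∈ Finset.univ.filter (fun k => k < j ∧ k ∉ S), c j k * x k) + c j j := by
  rw [mem_coeffMats] at hc
  unfold affForm
  congr 2
  symm
  apply Finset.sum_subset
  · intro k hk
    simp at hk ⊢
    exact hk.1
  · intro k hk hk'
    simp at hk hk'
    by_cases h : c j k = 0
    · simp [h]
    · rcases (hc j k h).2 with h1 | h1
      · exact absurd h1 hk.ne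
      · exact absurd (hk' hk) h1.2

lemma matPoly_injOn {m : ℕ} (S : Finset (Fin m)) :
    Set.InjOn (matPoly S) (coeffMats S : Set (Fin m → Fin m → ZMod 2)) := by
  intro c hc d hd hcd
  rw [Finset.mem_coe] at hc hd
  have key : ∀ j ∈ S, ∀ y : Pt m,
      (∑ k ∈ Finset.univ.filter (fun k => k < j ∧ k ∉ S), c j k * y k) + c j j =
      (∑ k ∈ Finset.univ.filter (fun k => k < j ∧ k ∉ S), d j k * y k) + d j j := by
    intro j hj y
    let x : Pt m := fun i => if i ∈ S then
      1 + ((∑ k ∈ Finset.univ.filter (fun k => k < i ∧ k ∉ S), c i k * y k) + c i i) else y i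
    have hx : ∀ (e : Fin m → Fin m → ZMod 2) (i : Fin m),
        (∑ k ∈ Finset.univ.filter (fun k => k < i ∧ k ∉ S), e i k * x k) =
        ∑ k ∈ Finset.univ.filter (fun k => k < i ∧ k ∉ S), e i k * y k := by
      intro e i
      apply Finset.sum_congr rfl
      intro k hk
      simp at hk
      simp [x, hk.2]
    have h1 : matPoly S c x = 1 := by
      unfold matPoly
      apply Finset.prod_eq_one
      intro i hi
      rw [affForm_eq hc, hx]
      have : x i = 1 +
        ((∑ k ∈ Finset.univ.filter (fun k => k < i ∧ k ∉ S), c i k * y k) + c i i) := by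
        simp [x, hi]
      rw [this, add_assoc, add_assoc, CharTwo.add_self_eq_zero, add_zero]
    rw [hcd] at h1
    have h2 : affForm j (d j) x ≠ 0 := by
      intro h0
      have : matPoly S d x = 0 := Finset.prod_eq_zero hj h0
      rw [this] at h1
      exact zero_ne_one h1
    have h3 := (zmod_two_eq_zero_or_one _).resolve_left h2
    rw [affForm_eq hd, hx] at h3
    have : x j = 1 +
        ((∑ k ∈ Finset.univ.filter (fun k => k < j ∧ k ∉ S), c j k * y k) + c j j) := by
      simp [x, hj]
    rw [this] at h3
    clear this
    generalize (∑ k ∈ Finset.univ.filter (fun k => k < j ∧ k ∉ S), c j k * y k) + c j j = u at *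
    rw [add_assoc] at h3
    generalize (∑ k ∈ Finset.univ.filter (fun k => k < j ∧ k ∉ S), d j k * y k) + d j j = v at *
    revert h3
    revert u v
    decide
  rw [mem_coeffMats] at hc hd
  have hdiag : ∀ j ∈ S, c j j = d j j := by
    intro j hj
    simpa using key j hj 0
  funext j k
  by_cases hjk : j ∈ S ∧ (k = j ∨ (k < j ∧ k ∉ S))
  · obtain ⟨hj, rfl | hk⟩ := hjk
    · exact hdiag _ hj
    · have := key j hj (Pi.single k 1)
      rw [hdiag j hj] at this
      simpa [Pi.single_apply, hk.1, hk.2] using this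
  · have h1 : c j k = 0 := by
      by_contra h
      exact hjk (hc j k h)
    have h2 : d j k = 0 := by
      by_contra h
      exact hjk (hd j k h)
    rw [h1, h2]

lemma mem_Tset_iff {m : ℕ} (S : Finset (Fin m)) (p : BPoly m) :
    p ∈ Tset S ↔ ∃ c ∈ coeffMats S, matPoly S c = p := by
  constructor
  · rintro ⟨c, c0, rfl⟩
    have hmem : (fun j k => if j ∈ S then (if k = j then c0 j else
        if k < j ∧ k ∉ S then c j k else 0) else 0) ∈ coeffMats S := by
      rw [mem_coeffMats]
      intro j k h
      grind
    refine ⟨_, hmem, ?_⟩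
    funext x
    apply Finset.prod_congr rfl
    intro j hj
    rw [affForm_eq hmem]
    simp only [hj, if_true]
    congr 2
    apply Finset.sum_congr rfl
    intro k hk
    simp at hk
    simp [hk.1, hk.2, hk.1.ne]
  · rintro ⟨c, hc, rfl⟩
    refine ⟨c, fun j => c j j, ?_⟩
    funext x
    exact Finset.prod_congr rfl fun j _ => affForm_eq hc j x

lemma Nfun_eq_card {m : ℕ} (S : Finset (Fin m)) (w a : ℕ) :
    Nfun S w a = ((coeffMats S).filter (fun c => wtIn (matPoly S c) 1 a = w)).card := by
  have h : {p : BPoly m | p ∈ Tset S ∧ wtIn p 1 a = w} =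
      matPoly S '' (((coeffMats S).filter (fun c => wtIn (matPoly S c) 1 a = w) :
        Finset _) : Set (Fin m → Fin m → ZMod 2)) := by
    ext p
    simp only [Set.mem_ofPred_eq, mem_Tset_iff, Set.mem_image, Finset.coe_filter]
    constructor
    · rintro ⟨⟨c, hc, rfl⟩, h⟩
      exact ⟨c, ⟨hc, h⟩, rfl⟩
    · rintro ⟨c, ⟨hc, h⟩, rfl⟩
      exact ⟨⟨c, hc, rfl⟩, h⟩
  rw [Nfun, h, Set.InjOn.ncard_image, Set.ncard_coe_finset]
  exact (matPoly_injOn S).mono fun c hc => by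
    simp at hc
    exact hc.1

lemma wtIn_congr {m : ℕ} {p q : BPoly m} {a : ℕ} (h : ∀ x, Dnat x ≤ a → p x = q x) :
    wtIn p 1 a = wtIn q 1 a := by
  unfold wtIn
  congr 1
  apply Finset.filter_congr
  intro x _
  constructor
  · rintro ⟨h1, h2, h3⟩
    exact ⟨h1, h2, h x h2 ▸ h3⟩
  · rintro ⟨h1, h2, h3⟩
    exact ⟨h1, h2, (h x h2).trans h3⟩

lemma eq_one_of_Dnat_le {m : ℕ} {M : Fin m} {x : Pt m} (h : Dnat x ≤ 2 ^ (M : ℕ)) : x M = 1 := by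
  refine (zmod_two_eq_zero_or_one _).resolve_left fun h0 => ?_
  have h1 : 2 ^ (M : ℕ) * (1 - (x M).val) ≤ ∑ i : Fin m, 2 ^ (i : ℕ) * (1 - (x i).val) :=
    Finset.single_le_sum (f := fun i : Fin m => 2 ^ (i : ℕ) * (1 - (x i).val))
      (fun _ _ => Nat.zero_le _) (Finset.mem_univ M)
  rw [h0] at h1
  simp [Dnat] at h h1
  omega

/-- The linear form in row `M` of `c`, restricted to the variables below `M`, has leading
variable `s`. -/
def IsLead {m : ℕ} (M s : Fin m) (c : Fin m → Fin m → ZMod 2) : Prop :=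
  s < M ∧ c M s = 1 ∧ ∀ k, s < k → k < M → c M k = 0

instance {m : ℕ} (M s : Fin m) : DecidablePred (IsLead M s) := fun _ => by
  unfold IsLead; infer_instance

/-- Move row `M`, with leading variable `s` and the variable `M` set to one, to row `s`, and use
it to eliminate the variable `s` from the other rows. -/
def elimRow {m : ℕ} (M s : Fin m) (c : Fin m → Fin m → ZMod 2) : Fin m → Fin m → ZMod 2 :=
  fun j k =>
    if j = s then (if k = s then c M M + 1 else if k < s then c M k else 0)
    else if j = M then 0
    else if k = j then c j j + c j s * c M M
    else if k < j then c j k + c j s * c M k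
    else 0

/-- The inverse of `elimRow M s`, where `u` is the set of rows containing the variable `s`. -/
def unelimRow {m : ℕ} (M s : Fin m) (d : Fin m → Fin m → ZMod 2) (u : Finset (Fin m)) :
    Fin m → Fin m → ZMod 2 :=
  fun j k =>
    if j = M then (if k = M then d s s + 1 else if k = s then 1 else d s k)
    else if j = s then 0
    else if j ∈ u then
      (if k = j then d j j + (d s s + 1)
        else if k < j then d j k + (if k = s then 1 else d s k) else 0)
    else d j k

lemma matPoly_elimRow {m : ℕ} {R : Finset (Fin m)} {M s : Fin m} (hR : ∀ j ∈ R, j < M)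
    (hs : s ∉ R) {c : Fin m → Fin m → ZMod 2} (hc : c ∈ coeffMats (insert M R))
    (hl : IsLead M s c) {x : Pt m} (hx : x M = 1) :
    matPoly (insert M R) c x = matPoly (insert s R) (elimRow M s c) x := by
  have hM : M ∉ R := fun h => lt_irrefl _ (hR M h)
  obtain ⟨hsM, hcs, hck⟩ := hl
  rw [mem_coeffMats] at hc
  have htrunc : ∀ j, s < j → j ≤ M →
      ∑ k ∈ Finset.Iio j, c M k * x k = (∑ k ∈ Finset.Iio s, c M k * x k) + x s := by
    intro j hj hjM
    have : ∑ k ∈ Finset.Iic s, c M k * x k = ∑ k ∈ Finset.Iio j, c M k * x k := by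
      apply Finset.sum_subset
      · intro k hk
        simp at hk ⊢
        exact hk.trans_lt hj
      · intro k hk hk'
        simp at hk hk'
        rw [hck k hk' (hk.trans_le hjM), zero_mul]
    rw [← this, ← Finset.Iio_insert, Finset.sum_insert (by simp), hcs, one_mul, add_comm]
  have hlead : affForm M (c M) x = affForm s (elimRow M s c s) x := by
    unfold affForm
    rw [htrunc M hsM le_rfl, hx]
    have : ∑ k ∈ Finset.Iio s, elimRow M s c s k * x k = ∑ k ∈ Finset.Iio s, c M k * x k := by
      apply Finset.sum_congr rfl
      intro k hk
      simp at hk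
      simp [elimRow, hk, hk.ne]
    rw [this]
    simp [elimRow]
    ring
  unfold matPoly
  rw [Finset.prod_insert hM, Finset.prod_insert hs, ← hlead]
  rcases zmod_two_eq_zero_or_one (affForm M (c M) x) with h | h
  · rw [h, zero_mul, zero_mul]
  · congr 1
    apply Finset.prod_congr rfl
    intro j hj
    have hjs : j ≠ s := fun h => hs (h ▸ hj)
    have hjM : j < M := hR j hj
    have hsum : ∑ k ∈ Finset.Iio j, elimRow M s c j k * x k =
        ∑ k ∈ Finset.Iio j, c j k * x k + c j s * ∑ k ∈ Finset.Iio j, c M k * x k := by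
      rw [Finset.mul_sum, ← Finset.sum_add_distrib]
      apply Finset.sum_congr rfl
      intro k hk
      simp at hk
      simp [elimRow, hk, hk.ne, hjs, hjM.ne]
      ring
    have hjj : elimRow M s c j j = c j j + c j s * c M M := by
      simp [elimRow, hjs, hjM.ne]
    unfold affForm
    rw [hsum, hjj]
    rcases zmod_two_eq_zero_or_one (c j s) with h0 | h1
    · simp [h0]
    · have hsj : s < j := by
        rcases (hc j s (by rw [h1]; exact one_ne_zero)).2 with h2 | h2
        · exact absurd h2.symm hjs
        · exact h2.1
      have h3 : ∑ k ∈ Finset.Iio j, c M k * x k + c M M = 0 := by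
        unfold affForm at h
        rw [htrunc M hsM le_rfl, ← htrunc j hsj hjM.le, hx, add_assoc] at h
        simpa using h
      rw [h1]
      linear_combination -h3

lemma elimRow_mem {m : ℕ} {R : Finset (Fin m)} {M s : Fin m} (hR : ∀ j ∈ R, j < M)
    (hs : s ∉ R) {c : Fin m → Fin m → ZMod 2} (hc : c ∈ coeffMats (insert M R))
    (hl : IsLead M s c) : elimRow M s c ∈ coeffMats (insert s R) := by
  rw [mem_coeffMats] at *
  obtain ⟨hsM, hcs, hck⟩ := hl
  intro j k
  have h1 := hc j k
  have h2 := hc M k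
  have h3 := hc j s
  have h4 := hc j j
  have h5 := hck k
  have h6 := hR j
  have h7 := hR k
  have h9 : ∀ x y z : ZMod 2, x + y * z ≠ 0 → x ≠ 0 ∨ (y ≠ 0 ∧ z ≠ 0) := by decide
  have h10 := h9 (c j k) (c j s) (c M k)
  have h11 := h9 (c j j) (c j s) (c M M)
  have h12 : k = s → c j k + c j s * c M k = 0 := by
    rintro rfl
    rw [hcs, mul_one, CharTwo.add_self_eq_zero]
  clear h9
  simp only [elimRow, Finset.mem_insert] at *
  clear hc
  split_ifs <;> grind

lemma unelimRow_mem {m : ℕ} {R : Finset (Fin m)} {M s : Fin m} (hR : ∀ j ∈ R, j < M)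
    (hs : s ∉ R) (hsM : s < M) {d : Fin m → Fin m → ZMod 2} (hd : d ∈ coeffMats (insert s R))
    {u : Finset (Fin m)} (hu : u ⊆ R.filter (s < ·)) :
    unelimRow M s d u ∈ coeffMats (insert M R) := by
  rw [mem_coeffMats] at *
  intro j k
  have h1 := hd j k
  have h2 := hd s k
  have h6 := hR j
  have h7 := hR k
  have h8 : j ∈ u → j ∈ R ∧ s < j := fun h => by simpa using hu h
  simp only [unelimRow, Finset.mem_insert] at *
  grind

lemma isLead_unelimRow {m : ℕ} {R : Finset (Fin m)} {M s : Fin m}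
    (hsM : s < M) {d : Fin m → Fin m → ZMod 2} (hd : d ∈ coeffMats (insert s R))
    (u : Finset (Fin m)) : IsLead M s (unelimRow M s d u) := by
  rw [mem_coeffMats] at hd
  refine ⟨hsM, by simp [unelimRow, hsM.ne], fun k hk hkM => ?_⟩
  have := hd s k
  simp only [unelimRow]
  grind

lemma unelimRow_elimRow {m : ℕ} {R : Finset (Fin m)} {M s : Fin m} (hR : ∀ j ∈ R, j < M)
    (hs : s ∉ R) {c : Fin m → Fin m → ZMod 2} (hc : c ∈ coeffMats (insert M R))
    (hl : IsLead M s c) :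
    unelimRow M s (elimRow M s c) ((R.filter (s < ·)).filter (fun j => c j s = 1)) = c := by
  rw [mem_coeffMats] at *
  obtain ⟨hsM, hcs, hck⟩ := hl
  funext j k
  have h1 := hc j k
  have h2 := hc M k
  have h3 := hc j s
  have h4 := hc j j
  have h5 := hck k
  have h6 := hR j
  have h7 := hR k
  have h8 : ∀ y : ZMod 2, y + y = 0 := by decide
  have h9 := zmod_two_eq_zero_or_one (c j s)
  have h10 := h8 (c M M)
  have h11 := h8 (c M k)
  have h12 := h8 1
  simp only [unelimRow, elimRow, Finset.mem_insert, Finset.mem_filter] at *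
  grind

lemma elimRow_unelimRow {m : ℕ} {R : Finset (Fin m)} {M s : Fin m} (hR : ∀ j ∈ R, j < M)
    (hsM : s < M) {d : Fin m → Fin m → ZMod 2} (hd : d ∈ coeffMats (insert s R))
    {u : Finset (Fin m)} (hu : u ⊆ R.filter (s < ·)) :
    elimRow M s (unelimRow M s d u) = d := by
  rw [mem_coeffMats] at *
  funext j k
  have h1 := hd j k
  have h2 := hd s k
  have h3 := hd j s
  have h4 := hd j j
  have h6 := hR j
  have h7 := hR k
  have h8 : j ∈ u → j ∈ R ∧ s < j := fun h => by simpa using hu h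
  have h9 : ∀ y : ZMod 2, y + y = 0 := by decide
  have h10 := h9 (d s s)
  have h11 := h9 (d s k)
  have h12 := h9 1
  simp only [unelimRow, elimRow, Finset.mem_insert] at *
  grind

lemma filter_unelimRow {m : ℕ} {R : Finset (Fin m)} {M s : Fin m} (hR : ∀ j ∈ R, j < M)
    {d : Fin m → Fin m → ZMod 2} (hd : d ∈ coeffMats (insert s R))
    {u : Finset (Fin m)} (hu : u ⊆ R.filter (s < ·)) :
    (R.filter (s < ·)).filter (fun j => unelimRow M s d u j s = 1) = u := by
  rw [mem_coeffMats] at *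
  ext j
  have h3 := hd j s
  have h6 := hR j
  have h8 : j ∈ u → j ∈ R ∧ s < j := fun h => by simpa using hu h
  have h9 : (0 : ZMod 2) ≠ 1 := zero_ne_one
  simp only [unelimRow, Finset.mem_insert, Finset.mem_filter] at *
  grind

lemma card_filter_isLead {m : ℕ} {R : Finset (Fin m)} {M s : Fin m} (hR : ∀ j ∈ R, j < M)
    (hs : s ∉ R) (hsM : s < M) (w : ℕ) {a : ℕ} (ha : a ≤ 2 ^ (M : ℕ)) :
    ((coeffMats (insert M R)).filter
      (fun c => wtIn (matPoly (insert M R) c) 1 a = w ∧ IsLead M s c)).card =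
    2 ^ (R.filter (s < ·)).card * Nfun (insert s R) w a := by
  have hwt : ∀ c ∈ coeffMats (insert M R), IsLead M s c →
      wtIn (matPoly (insert M R) c) 1 a = wtIn (matPoly (insert s R) (elimRow M s c)) 1 a :=
    fun c hc hl => wtIn_congr fun x hx =>
      matPoly_elimRow hR hs hc hl (eq_one_of_Dnat_le (hx.trans ha))
  rw [Nfun_eq_card, ← Finset.card_powerset, mul_comm, ← Finset.card_product]
  refine Finset.card_nbij'
    (fun c => (elimRow M s c, (R.filter (s < ·)).filter (fun j => c j s = 1)))
    (fun q => unelimRow M s q.1 q.2) ?_ ?_ ?_ ?_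
  · intro c hc
    simp only [Finset.coe_filter, Set.mem_ofPred_eq] at hc
    obtain ⟨hc, hw, hl⟩ := hc
    simp only [Finset.mem_coe, Finset.mem_product, Finset.mem_filter, Finset.mem_powerset]
    exact ⟨⟨elimRow_mem hR hs hc hl, hwt c hc hl ▸ hw⟩, Finset.filter_subset _ _⟩
  · rintro ⟨d, u⟩ hq
    simp only [Finset.mem_coe, Finset.mem_product, Finset.mem_filter, Finset.mem_powerset] at hq ⊢
    obtain ⟨⟨hd, hw⟩, hu⟩ := hq
    have h1 := unelimRow_mem hR hs hsM hd hu
    have h2 := isLead_unelimRow hsM hd u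
    refine ⟨h1, ?_, h2⟩
    rw [hwt _ h1 h2, elimRow_unelimRow hR hsM hd hu, hw]
  · intro c hc
    simp only [Finset.coe_filter, Set.mem_ofPred_eq] at hc
    exact unelimRow_elimRow hR hs hc.1 hc.2.2
  · rintro ⟨d, u⟩ hq
    simp only [Finset.mem_coe, Finset.mem_product, Finset.mem_filter, Finset.mem_powerset] at hq
    obtain ⟨⟨hd, hw⟩, hu⟩ := hq
    exact Prod.ext (elimRow_unelimRow hR hsM hd hu) (filter_unelimRow hR hd hu)

lemma card_filter_const {m : ℕ} {R : Finset (Fin m)} {M : Fin m} (hR : ∀ j ∈ R, j < M)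
    {w a : ℕ} (hw : 1 ≤ w) (ha : a ≤ 2 ^ (M : ℕ)) :
    ((coeffMats (insert M R)).filter
      (fun c => wtIn (matPoly (insert M R) c) 1 a = w ∧ ∀ k < M, c M k = 0)).card =
    Nfun R w a := by
  have hM : M ∉ R := fun h => lt_irrefl _ (hR M h)
  have hval : ∀ c : Fin m → Fin m → ZMod 2, (∀ k < M, c M k = 0) → ∀ x : Pt m, Dnat x ≤ a →
      matPoly (insert M R) c x = (1 + c M M) * matPoly R c x := by
    intro c hc x hx
    have h0 : ∑ k ∈ Finset.Iio M, c M k * x k = 0 := Finset.sum_eq_zero fun k hk => by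
      rw [hc k (Finset.mem_Iio.mp hk), zero_mul]
    unfold matPoly
    rw [Finset.prod_insert hM]
    congr 1
    rw [affForm, h0, eq_one_of_Dnat_le (hx.trans ha), add_zero]
  rw [Nfun_eq_card]
  congr 1
  ext c
  simp only [Finset.mem_filter]
  constructor
  · rintro ⟨hc, hcw, hk⟩
    have hMM : c M M = 0 := by
      refine (zmod_two_eq_zero_or_one _).resolve_right fun h1 => ?_
      have h2 : wtIn (matPoly (insert M R) c) 1 a = wtIn (fun _ => 0 : BPoly m) 1 a :=
        wtIn_congr fun x hx => by
          rw [hval c hk x hx, h1, CharTwo.add_self_eq_zero, zero_mul]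
      have h3 : wtIn (fun _ => 0 : BPoly m) 1 a = 0 := by simp [wtIn]
      omega
    refine ⟨?_, ?_⟩
    · rw [mem_coeffMats] at *
      intro j k
      have h1 := hc j k
      have h2 := hk k
      have h6 := hR j
      simp only [Finset.mem_insert] at *
      grind
    · rw [← hcw]
      exact wtIn_congr fun x hx => by rw [hval c hk x hx, hMM, add_zero, one_mul]
  · rintro ⟨hc, hcw⟩
    rw [mem_coeffMats] at hc
    have hrow : ∀ k, c M k = 0 := fun k => by
      by_contra h
      exact hM (hc M k h).1
    refine ⟨?_, ?_, fun k _ => hrow k⟩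
    · rw [mem_coeffMats]
      intro j k
      have h1 := hc j k
      have h6 := hR j
      simp only [Finset.mem_insert] at *
      grind
    · rw [← hcw]
      exact wtIn_congr fun x hx => by
        rw [hval c (fun k _ => hrow k) x hx, hrow, add_zero, one_mul]

lemma exists_isLead {m : ℕ} {M : Fin m} {c : Fin m → Fin m → ZMod 2}
    (h : ¬ ∀ k < M, c M k = 0) : ∃ s, IsLead M s c := by
  have hne : ((Finset.Iio M).filter (fun k => c M k ≠ 0)).Nonempty := by
    push Not at h
    obtain ⟨k, hk, hk'⟩ := h
    exact ⟨k, by simp [hk, hk']⟩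
  have hmem := Finset.max'_mem _ hne
  simp only [Finset.mem_filter, Finset.mem_Iio] at hmem
  refine ⟨_, hmem.1, (zmod_two_eq_zero_or_one _).resolve_left hmem.2, fun k hk hkM => ?_⟩
  by_contra h0
  exact absurd (Finset.le_max' _ k (by simp [hkM, h0])) (not_le.mpr hk)

lemma IsLead.unique {m : ℕ} {M s t : Fin m} {c : Fin m → Fin m → ZMod 2}
    (hs : IsLead M s c) (ht : IsLead M t c) : s = t := by
  have h01 : (1 : ZMod 2) ≠ 0 := one_ne_zero
  rcases lt_trichotomy s t with h | h | h
  · exact absurd (ht.2.1.symm.trans (hs.2.2 t h ht.1)) h01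
  · exact h
  · exact absurd (hs.2.1.symm.trans (ht.2.2 s h hs.1)) h01

lemma Nfun_insert {m : ℕ} {R : Finset (Fin m)} {M : Fin m} (hR : ∀ j ∈ R, j < M)
    {w a : ℕ} (hw : 1 ≤ w) (ha : a ≤ 2 ^ (M : ℕ)) :
    Nfun (insert M R) w a =
      (∑ s ∈ Finset.univ.filter (fun k : Fin m => k < M ∧ k ∉ R),
        2 ^ (R.filter (s < ·)).card * Nfun (insert s R) w a) + Nfun R w a := by
  rw [Nfun_eq_card (insert M R), ← Finset.card_filter_add_card_filter_not
    (fun c : Fin m → Fin m → ZMod 2 => ∀ k < M, c M k = 0), Finset.filter_filter,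
    card_filter_const hR hw ha, add_comm]
  congr 1
  have hsum : ∀ s ∈ Finset.univ.filter (fun k : Fin m => k < M ∧ k ∉ R),
      2 ^ (R.filter (s < ·)).card * Nfun (insert s R) w a =
      ((coeffMats (insert M R)).filter
        (fun c => wtIn (matPoly (insert M R) c) 1 a = w ∧ IsLead M s c)).card := by
    intro s hs
    simp only [Finset.mem_filter, Finset.mem_univ, true_and] at hs
    exact (card_filter_isLead hR hs.2 hs.1 w ha).symm
  rw [Finset.sum_congr rfl hsum, ← Finset.card_biUnion]
  · congr 1
    ext c
    simp only [Finset.mem_filter, Finset.mem_biUnion, Finset.mem_univ, true_and]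
    constructor
    · rintro ⟨⟨hc, hcw⟩, hk⟩
      obtain ⟨s, hs⟩ := exists_isLead hk
      refine ⟨s, ⟨hs.1, fun hsR => ?_⟩, hc, hcw, hs⟩
      rw [mem_coeffMats] at hc
      rcases (hc M s (by rw [hs.2.1]; exact one_ne_zero)).2 with h | h
      · exact hs.1.ne h
      · exact h.2 (Finset.mem_insert_of_mem hsR)
    · rintro ⟨s, -, hc, hcw, hs⟩
      refine ⟨⟨hc, hcw⟩, fun h => ?_⟩
      exact one_ne_zero (hs.2.1.symm.trans (h s hs.1))
  · intro s _ t _ hst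
    rw [Function.onFun_apply, Finset.disjoint_left]
    intro c hc hc'
    simp only [Finset.mem_filter] at hc hc'
    exact hst (hc.2.2.unique hc'.2.2)

/-- for f = x_{i_1}⋯x_{i_t}, t ≥ 2, with f^{(0)} = x_{i_1}⋯x_{i_{t-1}},
f^{(s)} the degree-t monomial with index set {i_1,…,i_{t-1},s} for s ∈ B(f,t), and
α_f(s) = |{1 ≤ j ≤ t-1 : i_j > s}|: for 0 ≤ a ≤ 2^{i_t - 1} and w ≥ 1,
N_f(w,a) = Σ_{s ∈ B(f,t)} 2^{α_f(s)} N_{f^{(s)}}(w,a) + N_{f^{(0)}}(w,a). -/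
theorem stmt7 (m : ℕ) (hm : 1 ≤ m) (S : Finset (Fin m)) (hS : 2 ≤ S.card)
    (hne : S.Nonempty) (w a : ℕ) (hw : 1 ≤ w) (ha : a ≤ 2 ^ ((S.max' hne : ℕ))) :
    Nfun S w a =
      (∑ s ∈ Finset.univ.filter (fun k : Fin m => k < S.max' hne ∧ k ∉ S),
          2 ^ (S.filter (fun k => s < k ∧ k ≠ S.max' hne)).card *
            Nfun (insert s (S.erase (S.max' hne))) w a)
        + Nfun (S.erase (S.max' hne)) w a := by
  have hR : ∀ j ∈ S.erase (S.max' hne), j < S.max' hne := fun j hj =>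
    S.lt_max'_of_mem_erase_max' hne hj
  have h := Nfun_insert hR hw ha
  rw [Finset.insert_erase (S.max'_mem hne)] at h
  rw [h]
  congr 1
  apply Finset.sum_congr
  · ext k
    simp only [Finset.mem_filter, Finset.mem_erase]
    grind
  · intro s _
    congr 3
    ext k
    simp only [Finset.mem_filter, Finset.mem_erase]
    tauto
end

section
/- Let f = x_{i_1}⋯x_{i_t} with 1 ≤ i_1 < ⋯ < i_t ≤ m and t ≥ 2. Then for every a with 2^{i_t−1} < a ≤ 2^{i_t} and every w with 0 ≤ w ≤ 2^{i_t−t}: N_f(w,a) = N_f(2^{i_t−t} − w, 2^{i_t} − a). -/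
open Finset

/-- Complementation of the coordinates up to `M`. -/
def flipLow {m : ℕ} (M : Fin m) (x : Pt m) : Pt m :=
  fun k => if k ≤ M then x k + 1 else x k

/-- The affine factor attached to the index `j` in an element of `Tset S`. -/
def affineFactor {m : ℕ} (S : Finset (Fin m)) (c : Fin m → Fin m → ZMod 2)
    (c0 : Fin m → ZMod 2) (j : Fin m) (x : Pt m) : ZMod 2 :=
  x j + (∑ k ∈ Finset.univ.filter (fun k => k < j ∧ k ∉ S), c j k * x k) + c0 j

/-- Replacement of each coordinate in `S` by the value of its affine factor. -/
def shear {m : ℕ} (S : Finset (Fin m)) (c : Fin m → Fin m → ZMod 2)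
    (c0 : Fin m → ZMod 2) (x : Pt m) : Pt m :=
  fun j => if j ∈ S then affineFactor S c c0 j x else x j

theorem flipLow_flipLow {m : ℕ} (M : Fin m) (x : Pt m) : flipLow M (flipLow M x) = x := by
  funext k
  by_cases hk : k ≤ M
  · simp only [flipLow, hk, if_true, add_assoc, CharTwo.add_self_eq_zero, add_zero]
  · simp [flipLow, hk]

theorem shear_shear {m : ℕ} (S : Finset (Fin m)) (c : Fin m → Fin m → ZMod 2)
    (c0 : Fin m → ZMod 2) (x : Pt m) : shear S c c0 (shear S c c0 x) = x := by
  funext j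
  by_cases hj : j ∈ S
  · have hsum : (∑ k ∈ Finset.univ.filter (fun k => k < j ∧ k ∉ S), c j k * shear S c c0 x k)
        = ∑ k ∈ Finset.univ.filter (fun k => k < j ∧ k ∉ S), c j k * x k := by
      refine Finset.sum_congr rfl fun k hk => ?_
      have hkS : k ∉ S := (Finset.mem_filter.mp hk).2.2
      simp [shear, hkS]
    have hval : shear S c c0 (shear S c c0 x) j = affineFactor S c c0 j (shear S c c0 x) :=
      if_pos hj
    have hinner : shear S c c0 x j = affineFactor S c c0 j x := if_pos hj
    rw [hval, affineFactor, hsum, hinner, affineFactor]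
    generalize (∑ k ∈ Finset.univ.filter (fun k => k < j ∧ k ∉ S), c j k * x k) = s
    linear_combination (s + c0 j) * (CharTwo.two_eq_zero : (2 : ZMod 2) = 0)
  · simp [shear, hj]

theorem one_le_Dnat {m : ℕ} (x : Pt m) : 1 ≤ Dnat x := Nat.le_add_left _ _

theorem sum_two_pow_le {m : ℕ} (M : Fin m) :
    (∑ i : Fin m, if i ≤ M then 2 ^ (i : ℕ) else 0) + 1 = 2 ^ ((M : ℕ) + 1) := by
  have hrange : (∑ i : Fin m, if i ≤ M then 2 ^ (i : ℕ) else 0)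
      = ∑ i ∈ Finset.range ((M : ℕ) + 1), 2 ^ i := by
    rw [← Finset.sum_filter]
    refine Finset.sum_nbij (fun i : Fin m => (i : ℕ)) ?_ ?_ ?_ ?_
    · intro i hi
      simp only [Finset.mem_filter, Finset.mem_univ, true_and, Fin.le_def] at hi
      simp only [Finset.mem_range]
      omega
    · exact fun i _ j _ h => Fin.ext h
    · intro n hn
      simp only [Finset.coe_range, Set.mem_Iio] at hn
      have hM := M.isLt
      refine ⟨⟨n, by omega⟩, ?_, rfl⟩
      simp only [Finset.coe_filter, Finset.mem_univ, true_and, Set.mem_ofPred_eq, Fin.le_def]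
      omega
    · exact fun _ _ => rfl
  rw [hrange, Nat.geomSum_eq le_rfl]
  have := Nat.one_le_two_pow (n := (M : ℕ) + 1)
  simp only [Nat.add_one_sub_one, Nat.div_one]
  omega

theorem Dnat_flipLow_add {m : ℕ} (M : Fin m) (x : Pt m) (hx : ∀ k, M < k → x k = 1) :
    Dnat (flipLow M x) + Dnat x = 2 ^ ((M : ℕ) + 1) + 1 := by
  have hsum : (∑ i : Fin m, 2 ^ (i : ℕ) * (1 - (flipLow M x i).val))
      + (∑ i : Fin m, 2 ^ (i : ℕ) * (1 - (x i).val))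
      = ∑ i : Fin m, if i ≤ M then 2 ^ (i : ℕ) else 0 := by
    rw [← Finset.sum_add_distrib]
    refine Finset.sum_congr rfl fun i _ => ?_
    have hbit : ∀ b : ZMod 2, (1 - (b + 1).val) + (1 - b.val) = 1 := by decide
    by_cases hi : i ≤ M
    · simp only [flipLow, hi, if_true]
      rw [← mul_add, hbit, mul_one]
    · simp [flipLow, hi, hx i (not_le.mp hi), ZMod.val_one]
  have := sum_two_pow_le M
  simp only [Dnat]
  omega

theorem Dnat_le_two_pow_iff {m : ℕ} (M : Fin m) (x : Pt m) :
    Dnat x ≤ 2 ^ ((M : ℕ) + 1) ↔ ∀ k, M < k → x k = 1 := by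
  constructor
  · intro h k hk
    by_contra hne
    have h0 : x k = 0 := by
      have hbit : ∀ b : ZMod 2, b ≠ 1 → b = 0 := by decide
      exact hbit _ hne
    have hterm : 2 ^ (k : ℕ) * (1 - (x k).val)
        ≤ ∑ i : Fin m, 2 ^ (i : ℕ) * (1 - (x i).val) :=
      Finset.single_le_sum (f := fun i : Fin m => 2 ^ (i : ℕ) * (1 - (x i).val))
        (fun _ _ => Nat.zero_le _) (Finset.mem_univ k)
    have hpow : 2 ^ ((M : ℕ) + 1) ≤ 2 ^ (k : ℕ) := Nat.pow_le_pow_right two_pos hk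
    simp only [h0, ZMod.val_zero, Nat.sub_zero, mul_one] at hterm
    simp only [Dnat] at h
    omega
  · intro hx
    have := Dnat_flipLow_add M x hx
    have := one_le_Dnat (flipLow M x)
    omega

theorem comp_flipLow_mem_Tset {m : ℕ} {S : Finset (Fin m)} {M : Fin m}
    (hM : ∀ j ∈ S, j ≤ M) {p : BPoly m} (hp : p ∈ Tset S) : p ∘ flipLow M ∈ Tset S := by
  obtain ⟨c, c0, rfl⟩ := hp
  refine ⟨c, fun j => 1 + (∑ k ∈ Finset.univ.filter (fun k => k < j ∧ k ∉ S), c j k) + c0 j, ?_⟩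
  funext x
  refine Finset.prod_congr rfl fun j hj => ?_
  have hsum : (∑ k ∈ Finset.univ.filter (fun k => k < j ∧ k ∉ S), c j k * flipLow M x k)
      = (∑ k ∈ Finset.univ.filter (fun k => k < j ∧ k ∉ S), c j k * x k)
        + ∑ k ∈ Finset.univ.filter (fun k => k < j ∧ k ∉ S), c j k := by
    rw [← Finset.sum_add_distrib]
    refine Finset.sum_congr rfl fun k hk => ?_
    have hkj : k < j := (Finset.mem_filter.mp hk).2.1
    simp only [flipLow, (hkj.le.trans (hM j hj)), if_true]
    ring
  rw [hsum]
  simp only [flipLow, hM j hj, if_true]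
  ring

theorem card_filter_eq_one_of_mem_Tset {m : ℕ} {S : Finset (Fin m)} {M : Fin m}
    (hM : ∀ j ∈ S, j ≤ M) {p : BPoly m} (hp : p ∈ Tset S) :
    (Finset.univ.filter (fun x : Pt m => (∀ k, M < k → x k = 1) ∧ p x = 1)).card
      = 2 ^ ((M : ℕ) + 1 - S.card) := by
  obtain ⟨c, c0, rfl⟩ := hp
  have hprod : ∀ y : Fin m → ZMod 2, ∏ j ∈ S, y j = 1 ↔ ∀ j ∈ S, y j = 1 := by
    refine fun y => ⟨fun h j hj => ?_, fun h => Finset.prod_eq_one h⟩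
    by_contra hne
    have hbit : ∀ b : ZMod 2, b ≠ 1 → b = 0 := by decide
    rw [Finset.prod_eq_zero hj (hbit _ hne)] at h
    exact zero_ne_one h
  have hcube : (Finset.univ.filter (fun x : Pt m => (∀ k, M < k → x k = 1) ∧
      ∏ j ∈ S, affineFactor S c c0 j x = 1)).card
      = (Fintype.piFinset (fun k : Fin m =>
          if k ∈ S ∨ M < k then ({1} : Finset (ZMod 2)) else Finset.univ)).card := by
    refine Finset.card_nbij' (shear S c c0) (shear S c c0) ?_ ?_
      (fun x _ => shear_shear S c c0 x) (fun x _ => shear_shear S c c0 x)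
    · intro x hx
      simp only [Finset.coe_filter, Finset.mem_univ, true_and, Set.mem_ofPred_eq, hprod] at hx
      simp only [Finset.mem_coe, Fintype.mem_piFinset]
      intro k
      by_cases hkS : k ∈ S
      · simpa [hkS, shear] using hx.2 k hkS
      · by_cases hkM : M < k
        · simpa [hkS, hkM, shear] using hx.1 k hkM
        · simp [hkS, hkM]
    · intro y hy
      simp only [Finset.mem_coe, Fintype.mem_piFinset] at hy
      simp only [Finset.coe_filter, Finset.mem_univ, true_and, Set.mem_ofPred_eq, hprod]
      refine ⟨fun k hk => ?_, fun j hj => ?_⟩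
      · have hkS : k ∉ S := fun h => absurd (hM k h) (not_le.mpr hk)
        simpa [shear, hkS, hk] using hy k
      · have hfactor : affineFactor S c c0 j (shear S c c0 y)
            = shear S c c0 (shear S c c0 y) j := (if_pos hj).symm
        rw [hfactor, shear_shear]
        simpa [hj] using hy j
  refine hcube.trans ?_
  rw [Fintype.card_piFinset]
  have hfree : ∀ k : Fin m,
      (if k ∈ S ∨ M < k then ({1} : Finset (ZMod 2)) else Finset.univ).card
        = if k ∈ Finset.Iic M \ S then 2 else 1 := by
    intro k
    by_cases hkS : k ∈ S
    · simp [hkS]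
    · by_cases hkM : M < k
      · simp [hkS, hkM]
      · simp [hkS, hkM, not_lt.mp hkM]
  simp only [hfree]
  rw [Finset.prod_ite_mem, Finset.univ_inter, Finset.prod_const,
    Finset.card_sdiff_of_subset (fun j hj => Finset.mem_Iic.mpr (hM j hj)), Fin.card_Iic]

theorem wtIn_add_wtIn_comp_flipLow {m : ℕ} {S : Finset (Fin m)} {M : Fin m}
    (hM : ∀ j ∈ S, j ≤ M) {p : BPoly m} (hp : p ∈ Tset S) {a : ℕ}
    (ha : a ≤ 2 ^ ((M : ℕ) + 1)) :
    wtIn p 1 a + wtIn (p ∘ flipLow M) 1 (2 ^ ((M : ℕ) + 1) - a)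
      = 2 ^ ((M : ℕ) + 1 - S.card) := by
  have hrefl : wtIn (p ∘ flipLow M) 1 (2 ^ ((M : ℕ) + 1) - a)
      = wtIn p (a + 1) (2 ^ ((M : ℕ) + 1)) := by
    refine Finset.card_nbij' (flipLow M) (flipLow M) ?_ ?_
      (fun x _ => flipLow_flipLow M x) (fun x _ => flipLow_flipLow M x)
    · intro x hx
      simp only [Finset.coe_filter, Finset.mem_univ, true_and, Set.mem_ofPred_eq] at hx ⊢
      obtain ⟨h1, h2, h3⟩ := hx
      have := Dnat_flipLow_add M x ((Dnat_le_two_pow_iff M x).mp (by omega))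
      exact ⟨by omega, by omega, h3⟩
    · intro x hx
      simp only [Finset.coe_filter, Finset.mem_univ, true_and, Set.mem_ofPred_eq] at hx ⊢
      obtain ⟨h1, h2, h3⟩ := hx
      have := Dnat_flipLow_add M x ((Dnat_le_two_pow_iff M x).mp h2)
      refine ⟨one_le_Dnat _, by omega, ?_⟩
      rwa [Function.comp_apply, flipLow_flipLow]
  rw [hrefl, ← card_filter_eq_one_of_mem_Tset hM hp, wtIn, wtIn, ← Finset.card_union_of_disjoint]
  · congr 1
    ext x
    have := one_le_Dnat x
    simp only [Finset.mem_union, Finset.mem_filter, Finset.mem_univ, true_and,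
      ← Dnat_le_two_pow_iff]
    by_cases hpx : p x = 1
    · simp only [hpx, and_true]
      omega
    · simp [hpx]
  · refine Finset.disjoint_filter.mpr fun x _ h1 h2 => ?_
    omega

/-- for f = x_{i_1}⋯x_{i_t}, t ≥ 2, i_t = max S + 1 (1-based):
for 2^{i_t-1} < a ≤ 2^{i_t} and 0 ≤ w ≤ 2^{i_t-t},
N_f(w,a) = N_f(2^{i_t-t} − w, 2^{i_t} − a). -/
theorem stmt8 (m : ℕ) (hm : 1 ≤ m) (S : Finset (Fin m)) (hS : 2 ≤ S.card)
    (hne : S.Nonempty) (w a : ℕ)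
    (ha1 : 2 ^ ((S.max' hne : ℕ)) < a) (ha2 : a ≤ 2 ^ ((S.max' hne : ℕ) + 1))
    (hw : w ≤ 2 ^ ((S.max' hne : ℕ) + 1 - S.card)) :
    Nfun S w a =
      Nfun S (2 ^ ((S.max' hne : ℕ) + 1 - S.card) - w) (2 ^ ((S.max' hne : ℕ) + 1) - a) := by
  set M := S.max' hne with hMdef
  have hM : ∀ j ∈ S, j ≤ M := fun j hj => S.le_max' j hj
  have hinv : ∀ p : BPoly m, (p ∘ flipLow M) ∘ flipLow M = p := fun p => by
    funext x
    simp only [Function.comp_apply, flipLow_flipLow]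
  refine Set.ncard_congr (fun p _ => p ∘ flipLow M) ?_ ?_ ?_
  · rintro p ⟨hp, hpw⟩
    have := wtIn_add_wtIn_comp_flipLow hM hp ha2
    exact ⟨comp_flipLow_mem_Tset hM hp, by omega⟩
  · intro p q _ _ hpq
    rw [← hinv p, ← hinv q]
    exact congrArg (· ∘ flipLow M) hpq
  · rintro q ⟨hq, hqw⟩
    have hq' := comp_flipLow_mem_Tset hM hq
    have hadd := wtIn_add_wtIn_comp_flipLow hM hq' ha2
    rw [hinv] at hadd
    exact ⟨q ∘ flipLow M, ⟨hq', by omega⟩, hinv q⟩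
end

section
/- Let t ≥ 1 and let 1 ≤ i_1 < i_2 < ⋯ < i_t be integers. Set B := {k ∈ ℕ : 1 ≤ k < i_t, k ∉ {i_1,…,i_t}}, and for s ∈ B let α(s) := |{1 ≤ j ≤ t−1 : i_j > s}|. Then Σ_{s∈B} 2^{α(s) + s} = 2^{i_t} − 2^t; equivalently, Σ_{s∈B} 2^{α(s) + s − t + 1} = 2^{i_t − t + 1} − 2. -/
open Finset

/-- B = {k : 1 ≤ k < i_t, k ∉ {i_1,…,i_t}}, where the 1-based increasing indices
i_1 < ⋯ < i_t are given by ι : Fin t → ℕ. -/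
def Bset10 (t : ℕ) (ht : 1 ≤ t) (ι : Fin t → ℕ) : Finset ℕ :=
  (Finset.range (ι ⟨t - 1, by omega⟩)).filter (fun k => 1 ≤ k ∧ ∀ j, ι j ≠ k)

/-- α(s) = |{1 ≤ j ≤ t-1 : i_j > s}|. -/
def alpha10 (t : ℕ) (ι : Fin t → ℕ) (s : ℕ) : ℕ :=
  (Finset.univ.filter (fun j : Fin t => (j : ℕ) < t - 1 ∧ s < ι j)).card

lemma alpha10_zero {t : ℕ} {ι : Fin t → ℕ} (h1 : ∀ j, 1 ≤ ι j) :
    alpha10 t ι 0 = t - 1 := by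
  have h : univ.filter (fun j : Fin t => (j : ℕ) < t - 1 ∧ 0 < ι j) =
      univ.filter (fun j : Fin t => (j : ℕ) < t - 1) := by
    ext j
    simp [Nat.lt_of_succ_le (h1 j)]
  rw [alpha10, h, Fin.card_filter_val_lt]
  omega

lemma alpha10_succ_of_forall_ne {t : ℕ} {ι : Fin t → ℕ} {n : ℕ}
    (h : ∀ j : Fin t, (j : ℕ) < t - 1 → ι j ≠ n + 1) :
    alpha10 t ι (n + 1) = alpha10 t ι n := by
  unfold alpha10
  congr 1
  ext j
  have := h j
  simp only [mem_filter, mem_univ, true_and]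
  omega

lemma alpha10_eq_succ_add_one {t : ℕ} {ι : Fin t → ℕ} (hmono : StrictMono ι) {n : ℕ}
    {j : Fin t} (hj : (j : ℕ) < t - 1) (h : ι j = n + 1) :
    alpha10 t ι n = alpha10 t ι (n + 1) + 1 := by
  unfold alpha10
  rw [← card_insert_of_notMem (a := j) (by simp [h])]
  congr 1
  ext k
  have hk : k = j ↔ ι k = n + 1 := by rw [← h, hmono.injective.eq_iff]
  simp only [mem_filter, mem_univ, true_and, mem_insert]
  by_cases hkj : k = j
  · subst hkj
    simp [hj, h]
  · have := mt hk.mpr hkj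
    simp only [hkj, false_or]
    omega

lemma alpha10_eq_zero {t : ℕ} (ht : 1 ≤ t) {ι : Fin t → ℕ} (hmono : StrictMono ι) {n : ℕ}
    (hn : ι ⟨t - 1, by omega⟩ = n + 1) : alpha10 t ι n = 0 := by
  rw [alpha10, card_eq_zero, filter_eq_empty_iff]
  rintro j - ⟨hj, hnj⟩
  have := hmono (show j < ⟨t - 1, by omega⟩ from hj)
  omega

lemma pred_le_alpha10_add {t : ℕ} {ι : Fin t → ℕ} (hmono : StrictMono ι) (h1 : ∀ j, 1 ≤ ι j)
    (n : ℕ) : t - 1 ≤ alpha10 t ι n + n := by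
  induction n with
  | zero => simp [alpha10_zero h1]
  | succ n ih =>
    by_cases h : ∃ j : Fin t, (j : ℕ) < t - 1 ∧ ι j = n + 1
    · obtain ⟨j, hj, h⟩ := h
      have := alpha10_eq_succ_add_one hmono hj h
      omega
    · have := alpha10_succ_of_forall_ne fun j hj hne => h ⟨j, hj, hne⟩
      omega

lemma le_alpha10_add_of_forall_ne {t : ℕ} {ι : Fin t → ℕ} (hmono : StrictMono ι)
    (h1 : ∀ j, 1 ≤ ι j) {s : ℕ} (hs : 1 ≤ s) (h : ∀ j, ι j ≠ s) : t ≤ alpha10 t ι s + s := by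
  obtain ⟨n, rfl⟩ := Nat.exists_eq_add_of_le' hs
  have := pred_le_alpha10_add hmono h1 n
  rw [alpha10_succ_of_forall_ne fun j _ => h j]
  omega

lemma sum_two_pow_alpha10_add {t : ℕ} (ht : 1 ≤ t) {ι : Fin t → ℕ} (hmono : StrictMono ι)
    (h1 : ∀ j, 1 ≤ ι j) {n : ℕ} (hn : n + 1 ≤ ι ⟨t - 1, by omega⟩) :
    ∑ s ∈ (range (n + 1)).filter (fun k => 1 ≤ k ∧ ∀ j, ι j ≠ k), 2 ^ (alpha10 t ι s + s) + 2 ^ t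
      = 2 ^ (alpha10 t ι n + (n + 1)) := by
  induction n with
  | zero =>
    rw [alpha10_zero h1, Nat.sub_add_cancel ht]
    simp [filter_singleton]
  | succ n ih =>
    have ih := ih (by omega)
    rw [range_add_one, filter_insert]
    by_cases h : ∀ j, ι j ≠ n + 1
    · rw [if_pos ⟨by omega, h⟩, sum_insert (by simp), add_assoc, ih,
        alpha10_succ_of_forall_ne fun j _ => h j]
      ring
    · rw [if_neg (fun h' => h h'.2), ih]
      push Not at h
      obtain ⟨j, hj⟩ := h
      have hlt : j < (⟨t - 1, by omega⟩ : Fin t) := hmono.lt_iff_lt.mp (by omega)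
      rw [alpha10_eq_succ_add_one hmono hlt hj]
      ring

/-- Σ_{s∈B} 2^{α(s)+s} = 2^{i_t} − 2^t; equivalently
Σ_{s∈B} 2^{α(s)+s−t+1} = 2^{i_t−t+1} − 2. -/
theorem stmt10 (t : ℕ) (ht : 1 ≤ t) (ι : Fin t → ℕ)
    (hmono : StrictMono ι) (h1 : ∀ j, 1 ≤ ι j) :
    (∑ s ∈ Bset10 t ht ι, 2 ^ (alpha10 t ι s + s) = 2 ^ (ι ⟨t - 1, by omega⟩) - 2 ^ t) ∧
    (∑ s ∈ Bset10 t ht ι, 2 ^ (alpha10 t ι s + s - t + 1)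
        = 2 ^ (ι ⟨t - 1, by omega⟩ - t + 1) - 2) := by
  obtain ⟨n, hn⟩ := Nat.exists_eq_add_of_le' (h1 ⟨t - 1, by omega⟩)
  have hα := alpha10_eq_zero ht hmono hn
  have hsum := sum_two_pow_alpha10_add ht hmono h1 hn.ge
  have hle := pred_le_alpha10_add hmono h1 n
  rw [hα, zero_add] at hsum
  have hB : Bset10 t ht ι = (range (n + 1)).filter (fun k => 1 ≤ k ∧ ∀ j, ι j ≠ k) := by
    rw [Bset10, hn]
  rw [hn, hB]
  refine ⟨by omega, ?_⟩
  have hscale : ∑ s ∈ (range (n + 1)).filter (fun k => 1 ≤ k ∧ ∀ j, ι j ≠ k),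
      2 ^ (alpha10 t ι s + s) = 2 ^ (t - 1) *
        ∑ s ∈ (range (n + 1)).filter (fun k => 1 ≤ k ∧ ∀ j, ι j ≠ k),
          2 ^ (alpha10 t ι s + s - t + 1) := by
    rw [mul_sum]
    refine sum_congr rfl fun s hs => ?_
    obtain ⟨-, hs, hne⟩ := mem_filter.mp hs
    have := le_alpha10_add_of_forall_ne hmono h1 hs hne
    rw [← pow_add]
    congr 1
    omega
  have hlast : 2 ^ (n + 1) = 2 ^ (t - 1) * 2 ^ (n + 1 - t + 1) := by
    rw [← pow_add]
    congr 1
    omega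
  have ht' : 2 ^ t = 2 ^ (t - 1) * 2 := by rw [← pow_succ, Nat.sub_add_cancel ht]
  rw [hscale, hlast, ht', ← mul_add] at hsum
  have := Nat.eq_of_mul_eq_mul_left (by positivity) hsum
  omega
end

section
/- Fix 1 ≤ j ≤ N and 0 ≤ i ≤ N. For every ũ ∈ 𝔽₂^N with ũ_k = 0 for all k < j and ũ_j = 1, the Hamming weight of the restriction of ũF_N to positions {i+1,…,N} is at least the Hamming weight of the restriction of the j-th row of F_N to positions {i+1,…,N}. In other words, the punctured j-th row of F_N is a minimum-weight codeword of the punctured polar coset {ũF_N : ũ_1^{j−1} = 0, ũ_j = 1} under the quasi-uniform puncturing pattern X_i = {1,…,i}. -/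
open Finset

/-- The matrix F_N (N = 2^m) over 𝔽₂, in the paper's indexing: the entry in row
D(a) and column D(b) (a,b ∈ 𝔽₂^m, D(a) = Σ 2^{i-1}(a_i ⊕ 1) + 1) equals
∏_{i : a_i = 1} b_i. With 0-based indices r = D(a) − 1, c = D(b) − 1 this reads:
a_i = 1 ⟺ ¬testBit r (i-1), b_i = 1 ⟺ ¬testBit c (i-1). -/
def Fmat (m : ℕ) : Matrix (Fin (2 ^ m)) (Fin (2 ^ m)) (ZMod 2) :=
  Matrix.of fun r c => ∏ i ∈ Finset.range m,
    (if (r : ℕ).testBit i = false then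
        (if (c : ℕ).testBit i = false then (1 : ZMod 2) else 0)
      else 1)

/-- Hamming weight of the restriction of a vector to positions {i+1,…,n}
(position k ∈ {1,…,n} corresponds to index k − 1 : Fin n). -/
def wtFrom {n : ℕ} (v : Fin n → ZMod 2) (i : ℕ) : ℕ :=
  (Finset.univ.filter (fun c : Fin n => i ≤ (c : ℕ) ∧ v c = 1)).card

/-- odd-indexed subvector v_o = (v_1, v_3, …, v_{N-1}) (1-based positions). -/
def oddPart {n : ℕ} (v : Fin (2 ^ (n + 1)) → ZMod 2) : Fin (2 ^ n) → ZMod 2 :=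
  fun k => v ⟨2 * (k : ℕ), by have h := k.isLt; rw [pow_succ]; omega⟩

/-- even-indexed subvector v_e = (v_2, v_4, …, v_N) (1-based positions). -/
def evenPart {n : ℕ} (v : Fin (2 ^ (n + 1)) → ZMod 2) : Fin (2 ^ n) → ZMod 2 :=
  fun k => v ⟨2 * (k : ℕ) + 1, by have h := k.isLt; rw [pow_succ]; omega⟩

/-- Punctured polar coset spectrum A_d(μ, v, Z): the number of ṽ ∈ 𝔽₂^{2^μ} whose
first j entries agree with v and such that the restriction of ṽF_{2^μ} to the
positions {1,…,2^μ} ∖ Z has Hamming weight d. -/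
noncomputable def Apunct (μ : ℕ) (j : ℕ) (v : ℕ → ZMod 2) (Z : Finset ℕ) (d : ℕ) : ℕ :=
  {w : Fin (2 ^ μ) → ZMod 2 |
    (∀ k : Fin (2 ^ μ), (k : ℕ) < j → w k = v (k : ℕ)) ∧
    (Finset.univ.filter (fun c : Fin (2 ^ μ) =>
        ((c : ℕ) + 1) ∉ Z ∧ Matrix.vecMul w (Fmat μ) c = 1)).card = d}.ncard

/-- Shortened polar coset spectrum A^S_d(μ, v, Z): additionally ṽF_{2^μ} must
vanish on all positions of Z. -/
noncomputable def Ashort (μ : ℕ) (j : ℕ) (v : ℕ → ZMod 2) (Z : Finset ℕ) (d : ℕ) : ℕ :=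
  {w : Fin (2 ^ μ) → ZMod 2 |
    (∀ k : Fin (2 ^ μ), (k : ℕ) < j → w k = v (k : ℕ)) ∧
    (∀ c : Fin (2 ^ μ), ((c : ℕ) + 1) ∈ Z → Matrix.vecMul w (Fmat μ) c = 0) ∧
    (Finset.univ.filter (fun c : Fin (2 ^ μ) =>
        ((c : ℕ) + 1) ∉ Z ∧ Matrix.vecMul w (Fmat μ) c = 1)).card = d}.ncard

/-- The entries of `Fmat m`, as a function of natural-number indices. -/
def fEntry (m r c : ℕ) : ZMod 2 :=
  ∏ i ∈ Finset.range m,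
    (if r.testBit i = false then (if c.testBit i = false then (1 : ZMod 2) else 0) else 1)

/-- The polar transform of the first `2 ^ m` entries of a sequence. -/
def polarT (m : ℕ) (u : ℕ → ZMod 2) (c : ℕ) : ZMod 2 :=
  ∑ r ∈ Finset.range (2 ^ m), u r * fEntry m r c

/-- The number of positions in `[i, n)` at which a sequence takes the value one. -/
def natWt (g : ℕ → ZMod 2) (n i : ℕ) : ℕ :=
  ∑ c ∈ Finset.range n, if i ≤ c ∧ g c = 1 then 1 else 0

theorem natWt_congr {g h : ℕ → ZMod 2} {n : ℕ} (i : ℕ) (H : ∀ c < n, g c = h c) :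
    natWt g n i = natWt h n i :=
  Finset.sum_congr rfl fun c hc => by rw [H c (Finset.mem_range.1 hc)]

theorem natWt_add (g : ℕ → ZMod 2) (n k i : ℕ) :
    natWt g (n + k) i = natWt g n i + natWt (fun c => g (n + c)) k (i - n) := by
  simp only [natWt, Finset.sum_range_add, tsub_le_iff_left]

theorem natWt_anti (g : ℕ → ZMod 2) (n : ℕ) {i k : ℕ} (h : i ≤ k) :
    natWt g n k ≤ natWt g n i := by
  refine Finset.sum_le_sum fun c _ => ?_
  split_ifs <;> grind

theorem natWt_le_add (g h : ℕ → ZMod 2) (n i : ℕ) :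
    natWt g n i ≤ natWt (fun c => g c + h c) n i + natWt h n i := by
  rw [natWt, natWt, natWt, ← Finset.sum_add_distrib]
  refine Finset.sum_le_sum fun c _ => ?_
  have key : ∀ a b : ZMod 2, a = 1 → b ≠ 1 → a + b = 1 := by decide
  have := key (g c) (h c)
  split_ifs <;> grind

theorem natWt_zero (n i : ℕ) : natWt (fun _ => 0) n i = 0 := by
  simp [natWt]

theorem fEntry_add_left (m r c : ℕ) : fEntry m (2 ^ m + r) c = fEntry m r c :=
  Finset.prod_congr rfl fun i hi => by
    rw [Nat.testBit_two_pow_add_gt (Finset.mem_range.1 hi)]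

theorem fEntry_add_right (m r c : ℕ) : fEntry m r (2 ^ m + c) = fEntry m r c :=
  Finset.prod_congr rfl fun i hi => by
    rw [Nat.testBit_two_pow_add_gt (Finset.mem_range.1 hi)]

theorem fEntry_succ_of_lt {m c : ℕ} (r : ℕ) (hc : c < 2 ^ m) :
    fEntry (m + 1) r c = fEntry m r c := by
  simp [fEntry, Finset.prod_range_succ, Nat.testBit_lt_two_pow hc]

theorem fEntry_succ_lt_add {m r c : ℕ} (hr : r < 2 ^ m) (hc : c < 2 ^ m) :
    fEntry (m + 1) r (2 ^ m + c) = 0 := by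
  simp [fEntry, Finset.prod_range_succ, Nat.testBit_lt_two_pow hr, Nat.testBit_two_pow_add_eq,
    Nat.testBit_lt_two_pow hc]

theorem fEntry_succ_add_add {m r : ℕ} (c : ℕ) (hr : r < 2 ^ m) :
    fEntry (m + 1) (2 ^ m + r) (2 ^ m + c) = fEntry m r c := by
  rw [← fEntry_add_left m r c, ← fEntry_add_right m (2 ^ m + r) c]
  simp [fEntry, Finset.prod_range_succ, Nat.testBit_two_pow_add_eq, Nat.testBit_lt_two_pow hr]

theorem polarT_succ_of_lt {m c : ℕ} (u : ℕ → ZMod 2) (hc : c < 2 ^ m) :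
    polarT (m + 1) u c = polarT m u c + polarT m (fun k => u (2 ^ m + k)) c := by
  simp only [polarT, pow_succ, mul_two, Finset.sum_range_add, fEntry_succ_of_lt _ hc,
    fEntry_add_left]

theorem polarT_succ_add {m c : ℕ} (u : ℕ → ZMod 2) (hc : c < 2 ^ m) :
    polarT (m + 1) u (2 ^ m + c) = polarT m (fun k => u (2 ^ m + k)) c := by
  simp only [polarT]
  rw [pow_succ, mul_two, Finset.sum_range_add, Finset.sum_eq_zero, zero_add]
  · exact Finset.sum_congr rfl fun r hr => by
      rw [fEntry_succ_add_add _ (Finset.mem_range.1 hr)]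
  · intro r hr
    rw [fEntry_succ_lt_add (Finset.mem_range.1 hr) hc, mul_zero]

theorem natWt_fEntry_le_natWt_polarT (m : ℕ) (u : ℕ → ZMod 2) (r i : ℕ) (hr : r < 2 ^ m)
    (hu0 : ∀ k < r, u k = 0) (hur : u r = 1) :
    natWt (fEntry m r) (2 ^ m) i ≤ natWt (polarT m u) (2 ^ m) i := by
  induction m generalizing u r i with
  | zero =>
    obtain rfl : r = 0 := by simpa using hr
    simp [natWt, fEntry, polarT, hur]
  | succ m ih =>
    rw [pow_succ, mul_two] at hr ⊢
    rw [natWt_add, natWt_add (polarT _ _), natWt_congr i fun c hc => fEntry_succ_of_lt r hc,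
      natWt_congr i fun c hc => polarT_succ_of_lt u hc,
      natWt_congr (i - 2 ^ m) fun c hc => polarT_succ_add u hc]
    rcases lt_or_ge r (2 ^ m) with h | h
    · rw [natWt_congr (i - 2 ^ m) fun c hc => fEntry_succ_lt_add h hc, natWt_zero, add_zero]
      calc natWt (fEntry m r) (2 ^ m) i ≤ natWt (polarT m u) (2 ^ m) i := ih u r i h hu0 hur
        _ ≤ _ := natWt_le_add _ (polarT m fun k => u (2 ^ m + k)) _ _
        _ ≤ _ := Nat.add_le_add_left (natWt_anti _ _ (Nat.sub_le _ _)) _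
    · obtain ⟨s, rfl⟩ := Nat.exists_eq_add_of_le h
      have hs : s < 2 ^ m := by omega
      have low (c : ℕ) : polarT m u c = 0 :=
        Finset.sum_eq_zero fun k hk => by
          rw [hu0 k (by have := Finset.mem_range.1 hk; omega), zero_mul]
      have ih' (l : ℕ) := ih (fun k => u (2 ^ m + k)) s l hs
        (fun k hk => hu0 _ (by omega)) hur
      simp only [low, zero_add, fEntry_succ_add_add _ hs]
      rw [natWt_congr i fun c _ => fEntry_add_left m s c]
      exact Nat.add_le_add (ih' i) (ih' (i - 2 ^ m))

theorem wtFrom_eq_natWt {n : ℕ} (v : Fin n → ZMod 2) (g : ℕ → ZMod 2) (i : ℕ)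
    (h : ∀ c : Fin n, v c = g c) : wtFrom v i = natWt g n i := by
  simp only [wtFrom, natWt, Finset.card_filter, h]
  exact Fin.sum_univ_eq_sum_range (fun c => if i ≤ c ∧ g c = 1 then 1 else 0) n

/-- the punctured j-th row of F_N is a minimum-weight codeword of the
punctured polar coset {ũF_N : ũ_1^{j-1} = 0, ũ_j = 1} under the quasi-uniform
puncturing pattern X_i = {1,…,i}. -/
theorem stmt11 (m : ℕ) (hm : 1 ≤ m) (j i : ℕ)
    (hj1 : 1 ≤ j) (hjN : j ≤ 2 ^ m) (hiN : i ≤ 2 ^ m)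
    (u : Fin (2 ^ m) → ZMod 2)
    (hu0 : ∀ k : Fin (2 ^ m), (k : ℕ) + 1 < j → u k = 0)
    (huj : ∀ k : Fin (2 ^ m), (k : ℕ) + 1 = j → u k = 1) :
    wtFrom (fun c => Fmat m ⟨j - 1, by omega⟩ c) i ≤ wtFrom (Matrix.vecMul u (Fmat m)) i := by
  let w : ℕ → ZMod 2 := fun k => if h : k < 2 ^ m then u ⟨k, h⟩ else 0
  refine (wtFrom_eq_natWt _ (fEntry m (j - 1)) i fun c => rfl).trans_le
    (le_of_le_of_eq ?_ (wtFrom_eq_natWt _ (polarT m w) i fun c => ?_).symm)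
  · refine natWt_fEntry_le_natWt_polarT m w (j - 1) i (by omega) (fun k hk => ?_) ?_
    · have hk' : k < 2 ^ m := by omega
      simp only [w, dif_pos hk']
      exact hu0 _ (by simp only; omega)
    · have hk' : j - 1 < 2 ^ m := by omega
      simp only [w, dif_pos hk']
      exact huj _ (by simp only; omega)
  · rw [polarT, ← Fin.sum_univ_eq_sum_range (fun r => w r * fEntry m r c)]
    simp [w, Matrix.vecMul, dotProduct, Fmat, fEntry]
end
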